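/- arXiv:1603.07779 — 3 statements merged into one kernel-verified Lean document; each statement's English description precedes it below -/
import Mathlib

section
/- There exists a constant ε > 0 such that for every n₀ ∈ ℕ there is an even n ≥ n₀ for which the partial 0-1 matrix M = f∘gⁿ (where f is the partial function with f(z)=1 if |z|=n/2 and f(z)=0 if |z|=0, and g is the confounding gadget) satisfies rank₀₁(M) ≥ 2^{(rank₊(M))^ε}. In particular, there is a family of partial 0-1 matrices whose binary rank is exponential in a fixed positive power of their nonnegative rank. -/
/-- The Hamming weight of `z ∈ {0,1}ⁿ`. -/
def hw {n : ℕ} (z : Fin n → Bool) : ℕ :=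
  (Finset.univ.filter fun i => z i = true).card

/-- The partial function `f : {0,1}ⁿ → {0,1}` with `f z = 1` if `|z| = n/2` and
`f z = 0` if `|z| = 0` (undefined, i.e. `none`, elsewhere). -/
def fPartial (n : ℕ) (z : Fin n → Bool) : Option Bool :=
  if hw z = n / 2 then some true else if hw z = 0 then some false else none

/-- `gⁿ(x,y) = (g(x₁,y₁), …, g(xₙ,yₙ))`. -/
def gpow {b n : ℕ} (g : (Fin b → Bool) → (Fin b → Bool) → Bool)
    (x y : Fin n → Fin b → Bool) : Fin n → Bool :=
  fun i => g (x i) (y i)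

/-- The composed partial 0-1 matrix `f ∘ gⁿ`, with rows indexed by
`x ∈ ({0,1}^b)ⁿ` and columns by `y ∈ ({0,1}^b)ⁿ`; `none` denotes a `*` entry. -/
def composed (b n : ℕ) (g : (Fin b → Bool) → (Fin b → Bool) → Bool)
    (x y : Fin n → Fin b → Bool) : Option Bool :=
  fPartial n (gpow g x y)

/-- The inner product modulo 2 gadget on `b`-bit strings. -/
def IP (b : ℕ) (u v : Fin b → Bool) : Bool :=
  decide ((∑ i : Fin b, (u i).toNat * (v i).toNat) % 2 = 1)

/-- The number of bits `b(n) = ⌈100 log₂ n⌉` of the confounding gadget. -/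
noncomputable def bOf (n : ℕ) : ℕ := ⌈(100 : ℝ) * Real.logb 2 n⌉₊

/-- A total entrywise-nonnegative matrix agreeing with the partial 0-1 matrix `M` on its
non-`*` entries is a sum of `r` entrywise-nonnegative rank-at-most-1 real matrices. -/
def PNNDecomp {α β : Type*} (M : α → β → Option Bool) (r : ℕ) : Prop :=
  ∃ (u : Fin r → α → ℝ) (v : Fin r → β → ℝ),
    (∀ k i, 0 ≤ u k i) ∧ (∀ k j, 0 ≤ v k j) ∧
    ∀ i j, (M i j = some true → ∑ k, u k i * v k j = 1) ∧
      (M i j = some false → ∑ k, u k i * v k j = 0)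

/-- The nonnegative rank of a partial 0-1 matrix. -/
noncomputable def pnnRank {α β : Type*} (M : α → β → Option Bool) : ℕ :=
  sInf {r | PNNDecomp M r}

/-- `r` combinatorial rectangles such that every 1-entry of the partial 0-1 matrix `M`
lies in exactly one of them and no 0-entry lies in any of them. -/
def PBinCover {α β : Type*} (M : α → β → Option Bool) (r : ℕ) : Prop :=
  ∃ (A : Fin r → Set α) (B : Fin r → Set β),
    (∀ i j, M i j = some true → ∃! k : Fin r, i ∈ A k ∧ j ∈ B k) ∧
    (∀ i j, M i j = some false → ∀ k : Fin r, ¬(i ∈ A k ∧ j ∈ B k))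

/-- The binary rank of a partial 0-1 matrix: the minimum number of rectangles covering
each 1-entry exactly once and no 0-entry. -/
noncomputable def pbinRank {α β : Type*} (M : α → β → Option Bool) : ℕ :=
  sInf {r | PBinCover M r}

section Lifting

open Finset
open scoped Classical

variable {ι V : Type*}

/-- The `±1`-valued version of a two-party gadget. -/
noncomputable def gadgetSign (g : V → V → Bool) (u v : V) : ℝ := if g u v then -1 else 1

/-- The sign matrix of the gadget has pairwise orthogonal columns. -/
def IsHadamard [Fintype V] (g : V → V → Bool) : Prop :=
  ∀ v v', ∑ u, gadgetSign g u v * gadgetSign g u v' = if v = v' then (Fintype.card V : ℝ) else 0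

/-- Parseval's identity for the characters supported on a set of coordinates. -/
theorem sum_sq_sum_prod_gadgetSign [Fintype V] {g : V → V → Bool} (hg : IsHadamard g) (S : Finset ι)
    (Y : Finset (ι → V)) :
    ∑ w : S → V, (∑ y ∈ Y, ∏ i : S, gadgetSign g (w i) (y i)) ^ 2 =
      (Fintype.card V : ℝ) ^ #S * ∑ y ∈ Y, (#{y' ∈ Y | S.restrict y' = S.restrict y} : ℝ) := by
  have h1 : ∀ y y' : ι → V, ∑ w : S → V, ∏ i : S,
      (gadgetSign g (w i) (y i) * gadgetSign g (w i) (y' i)) =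
      if S.restrict y' = S.restrict y then (Fintype.card V : ℝ) ^ #S else 0 := by
    intro y y'
    have := Finset.prod_univ_sum (fun _ : S => (univ : Finset V))
      (fun i v => gadgetSign g v (y i) * gadgetSign g v (y' i))
    rw [Fintype.piFinset_univ] at this
    rw [← this]
    simp only [hg _ _]
    split_ifs with h
    · have : ∀ i : S, y i = y' i := fun i => (congrFun h i).symm
      simp [this]
    · obtain ⟨i, hi⟩ := Function.ne_iff.1 h
      exact Finset.prod_eq_zero (mem_univ i) (if_neg fun h => hi h.symm)
  simp only [sq, Finset.sum_mul_sum, ← Finset.prod_mul_distrib]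
  rw [Finset.sum_comm, Finset.mul_sum]
  refine Finset.sum_congr rfl fun y _ => ?_
  rw [Finset.sum_comm]
  simp only [h1]
  rw [← Finset.sum_filter, Finset.sum_const, nsmul_eq_mul, mul_comm]

/-- `X` is spread on `F`: fixing a set `S ⊆ F` of coordinates leaves at most a
`δ ^ |S|` fraction of `X`. -/
def IsSpread (δ : ℝ) (F : Finset ι) (X : Finset (ι → V)) : Prop :=
  ∀ S ⊆ F, ∀ a : ι → V, (#{x ∈ X | S.restrict x = S.restrict a} : ℝ) ≤ δ ^ #S * #X

theorem sq_sum_prod_gadgetSign_le [Fintype V] {g : V → V → Bool} (hg : IsHadamard g) {δ : ℝ}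
    {F S : Finset ι} (hS : S ⊆ F) {X Y : Finset (ι → V)} (hX : IsSpread δ F X)
    (hY : IsSpread δ F Y) :
    (∑ x ∈ X, ∑ y ∈ Y, ∏ i ∈ S, gadgetSign g (x i) (y i)) ^ 2 ≤
      ((Fintype.card V : ℝ) * δ ^ 2) ^ #S * (#X * #Y : ℝ) ^ 2 := by
  set H : (S → V) → ℝ := fun w => ∑ y ∈ Y, ∏ i : S, gadgetSign g (w i) (y i) with hH
  have e1 : ∀ x : ι → V, ∑ y ∈ Y, ∏ i ∈ S, gadgetSign g (x i) (y i) = H (S.restrict x) := by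
    intro x
    refine Finset.sum_congr rfl fun y _ => ?_
    rw [← Finset.prod_coe_sort]
    rfl
  simp only [e1]
  have e2 : ∑ x ∈ X, H (S.restrict x) ^ 2 ≤ ∑ w : S → V, (δ ^ #S * #X) * H w ^ 2 := by
    rw [← Finset.sum_fiberwise X S.restrict]
    refine Finset.sum_le_sum fun w _ => ?_
    have : ∑ x ∈ X with S.restrict x = w, H (S.restrict x) ^ 2 =
        #{x ∈ X | S.restrict x = w} * H w ^ 2 := by
      rw [← nsmul_eq_mul, ← Finset.sum_const]
      refine Finset.sum_congr rfl fun x hx => ?_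
      rw [(Finset.mem_filter.1 hx).2]
    rw [this]
    refine mul_le_mul_of_nonneg_right ?_ (sq_nonneg _)
    by_cases hw : ∃ a : ι → V, S.restrict a = w
    · obtain ⟨a, rfl⟩ := hw
      exact hX S hS a
    · have : #{x ∈ X | S.restrict x = w} = 0 := by
        rw [Finset.card_eq_zero, Finset.filter_eq_empty_iff]
        exact fun x _ h => hw ⟨x, h⟩
      rw [this, Nat.cast_zero]
      by_cases hne : X.Nonempty
      · obtain ⟨x, hx⟩ := hne
        exact (Nat.cast_nonneg _).trans (hX S hS x)
      · simp [Finset.not_nonempty_iff_eq_empty.1 hne]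
  have e3 : ∑ w, H w ^ 2 ≤ (Fintype.card V : ℝ) ^ #S * (δ ^ #S * #Y ^ 2) := by
    rw [hH, sum_sq_sum_prod_gadgetSign hg]
    refine mul_le_mul_of_nonneg_left ?_ (by positivity)
    calc _ ≤ ∑ y ∈ Y, (δ ^ #S * #Y) := Finset.sum_le_sum fun y _ => hY S hS y
      _ = _ := by rw [Finset.sum_const, nsmul_eq_mul]; ring
  by_cases hne : X.Nonempty
  swap
  · simp [Finset.not_nonempty_iff_eq_empty.1 hne]
  obtain ⟨x₀, hx₀⟩ := hne
  have hδ : 0 ≤ δ ^ #S * #X := le_trans (by positivity) (hX S hS x₀)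
  calc _ ≤ (#X : ℝ) * ∑ x ∈ X, H (S.restrict x) ^ 2 := sq_sum_le_card_mul_sum_sq
    _ ≤ #X * ((δ ^ #S * #X) * ((Fintype.card V : ℝ) ^ #S * (δ ^ #S * #Y ^ 2))) := by
        refine mul_le_mul_of_nonneg_left (e2.trans ?_) (by positivity)
        rw [← Finset.mul_sum]
        exact mul_le_mul_of_nonneg_left e3 hδ
    _ = _ := by rw [mul_pow, ← pow_mul]; ring

/-- On spread rectangles the gadget attains every output pattern. -/
theorem exists_gadget_eq_of_isSpread [Fintype V] {g : V → V → Bool} (hg : IsHadamard g) {K : ℝ} (hK : 0 < K)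
    (hKV : (Fintype.card V : ℝ) = K ^ 2) {F : Finset ι} (hF : 4 * (#F : ℝ) ≤ K)
    {X Y : Finset (ι → V)} (hXne : X.Nonempty) (hYne : Y.Nonempty)
    (hX : IsSpread (2 / K ^ 2) F X) (hY : IsSpread (2 / K ^ 2) F Y) (ζ : ι → Bool) :
    ∃ x ∈ X, ∃ y ∈ Y, ∀ i ∈ F, g (x i) (y i) = ζ i := by
  by_contra! hcon
  set θ : ι → ℝ := fun i => if ζ i then -1 else 1 with hθ
  have hzero : ∀ x ∈ X, ∀ y ∈ Y, ∏ i ∈ F, (1 + θ i * gadgetSign g (x i) (y i)) = 0 := by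
    intro x hx y hy
    obtain ⟨i, hi, hne⟩ := hcon x hx y hy
    refine Finset.prod_eq_zero hi ?_
    simp only [hθ, gadgetSign]
    cases h1 : g (x i) (y i) <;> cases h2 : ζ i <;> simp_all
  have hsum : ∑ S ∈ F.powerset, (∏ i ∈ S, θ i) *
      ∑ x ∈ X, ∑ y ∈ Y, ∏ i ∈ S, gadgetSign g (x i) (y i) = 0 := by
    have : ∑ x ∈ X, ∑ y ∈ Y, ∏ i ∈ F, (1 + θ i * gadgetSign g (x i) (y i)) = 0 :=
      Finset.sum_eq_zero fun x hx => Finset.sum_eq_zero fun y hy => hzero x hx y hy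
    simp only [Finset.prod_one_add, Finset.prod_mul_distrib] at this
    rw [← this]
    simp only [Finset.mul_sum]
    rw [Finset.sum_comm]
    refine Finset.sum_congr rfl fun x _ => ?_
    rw [Finset.sum_comm]
  have hbound : ∀ S ∈ F.powerset, |(∏ i ∈ S, θ i) *
      ∑ x ∈ X, ∑ y ∈ Y, ∏ i ∈ S, gadgetSign g (x i) (y i)| ≤ (2 / K) ^ #S * (#X * #Y) := by
    intro S hS
    have h1 : |∏ i ∈ S, θ i| = 1 := by
      rw [Finset.abs_prod]
      refine Finset.prod_eq_one fun i _ => ?_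
      simp only [hθ]
      split_ifs <;> simp
    rw [abs_mul, h1, one_mul]
    refine abs_le_of_sq_le_sq ?_ (by positivity)
    refine (sq_sum_prod_gadgetSign_le hg (Finset.mem_powerset.1 hS) hX hY).trans_eq ?_
    have : (Fintype.card V : ℝ) * (2 / K ^ 2) ^ 2 = (2 / K) ^ 2 := by
      rw [hKV]; field_simp
    rw [this, pow_right_comm, mul_pow, mul_pow, mul_pow]
  have hpos : (0 : ℝ) < #X * #Y := by
    have := hXne.card_pos
    have := hYne.card_pos
    positivity
  have htot : ∑ S ∈ F.powerset.erase ∅, (2 / K) ^ #S < (1 : ℝ) := by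
    have h1 : ∑ S ∈ F.powerset, (2 / K) ^ #S = (1 + 2 / K) ^ #F := by
      have := Finset.sum_pow_mul_eq_add_pow (2 / K) 1 F
      simpa [add_comm] using this
    have h2 : ∑ S ∈ F.powerset.erase ∅, (2 / K) ^ #S + (2 / K) ^ #(∅ : Finset ι) =
        ∑ S ∈ F.powerset, (2 / K) ^ #S := Finset.sum_erase_add _ _ (by simp)
    have h3 : (1 + 2 / K) ^ #F < 2 := by
      calc (1 + 2 / K) ^ #F ≤ (Real.exp (2 / K)) ^ #F := by
            refine pow_le_pow_left₀ (by positivity) ?_ _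
            linarith [Real.add_one_le_exp (2 / K)]
        _ = Real.exp (#F * (2 / K)) := by rw [← Real.exp_nat_mul]
        _ ≤ Real.exp (1 / 2) := by
            refine Real.exp_le_exp.2 ?_
            rw [mul_div_assoc', div_le_iff₀ hK]
            linarith
        _ < 2 := by
            have h4 : Real.exp (1 / 2) ^ 2 < 2 ^ 2 := by
              rw [← Real.exp_nat_mul]
              have := Real.exp_one_lt_d9
              norm_num
              linarith
            exact lt_of_pow_lt_pow_left₀ 2 (by norm_num) h4
    rw [Finset.card_empty, pow_zero] at h2
    linarith
  rw [← Finset.sum_erase_add _ _ (show (∅ : Finset ι) ∈ F.powerset by simp)] at hsum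
  simp only [Finset.prod_empty, one_mul, Finset.sum_const, nsmul_eq_mul, mul_one] at hsum
  have h5 := Finset.abs_sum_le_sum_abs (fun S => (∏ i ∈ S, θ i) *
      ∑ x ∈ X, ∑ y ∈ Y, ∏ i ∈ S, gadgetSign g (x i) (y i)) (F.powerset.erase ∅)
  have h6 : ∑ S ∈ F.powerset.erase ∅, |(∏ i ∈ S, θ i) *
      ∑ x ∈ X, ∑ y ∈ Y, ∏ i ∈ S, gadgetSign g (x i) (y i)| ≤
      ∑ S ∈ F.powerset.erase ∅, (2 / K) ^ #S * (#X * #Y : ℝ) :=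
    Finset.sum_le_sum fun S hS => hbound S (Finset.mem_of_mem_erase hS)
  rw [← Finset.sum_mul] at h6
  have h7 := mul_lt_mul_of_pos_right htot hpos
  have h8 := neg_abs_le (∑ S ∈ F.powerset.erase ∅, (∏ i ∈ S, θ i) *
      ∑ x ∈ X, ∑ y ∈ Y, ∏ i ∈ S, gadgetSign g (x i) (y i))
  linarith

/-- The elements of `X` that agree with `a` on `J`. -/
noncomputable def fiber (J : Finset ι) (a : ι → V) (X : Finset (ι → V)) : Finset (ι → V) :=
  {x ∈ X | J.restrict x = J.restrict a}

theorem restrict_eq_restrict_iff {J : Finset ι} {x y : ι → V} :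
    J.restrict x = J.restrict y ↔ ∀ i ∈ J, x i = y i := by
  simp [funext_iff]

theorem mem_fiber {J : Finset ι} {a x : ι → V} {X : Finset (ι → V)} :
    x ∈ fiber J a X ↔ x ∈ X ∧ ∀ i ∈ J, x i = a i := by
  rw [fiber, Finset.mem_filter, restrict_eq_restrict_iff]

/-- Distinct elements of `X` differ somewhere on `F`. -/
def InjOnCoords (F : Finset ι) (X : Finset (ι → V)) : Prop :=
  ∀ x ∈ X, ∀ x' ∈ X, (∀ i ∈ F, x i = x' i) → x = x'

theorem card_fiber_le [Fintype V] {F J : Finset ι} (hJ : J ⊆ F) {X : Finset (ι → V)} (hX : InjOnCoords F X)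
    (a : ι → V) : #(fiber J a X) ≤ Fintype.card V ^ (#F - #J) := by
  have h : #((fiber J a X).image (F \ J).restrict) = #(fiber J a X) := by
    refine Finset.card_image_of_injOn fun x hx x' hx' hxx' => ?_
    have h1 := mem_fiber.1 (Finset.mem_coe.1 hx)
    have h2 := mem_fiber.1 (Finset.mem_coe.1 hx')
    refine hX x h1.1 x' h2.1 fun i hi => ?_
    by_cases hiJ : i ∈ J
    · rw [h1.2 i hiJ, h2.2 i hiJ]
    · exact restrict_eq_restrict_iff.1 hxx' i (Finset.mem_sdiff.2 ⟨hi, hiJ⟩)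
  rw [← h, ← Finset.card_sdiff_of_subset hJ]
  refine (Finset.card_le_univ _).trans_eq ?_
  simp

theorem exists_card_le_mul_card_fiber [Fintype V] (S : Finset ι) {Y : Finset (ι → V)} (hY : Y.Nonempty) :
    ∃ y ∈ Y, #Y ≤ Fintype.card V ^ #S * #(fiber S y Y) := by
  by_contra! h
  have h1 : #Y = ∑ w ∈ Y.image S.restrict, #{y ∈ Y | S.restrict y = w} :=
    Finset.card_eq_sum_card_image _ _
  have h2 : Fintype.card V ^ #S * #Y < #(Y.image S.restrict) * #Y := by
    conv_lhs => rw [h1]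
    rw [Finset.mul_sum, ← smul_eq_mul #(Y.image _), ← Finset.sum_const]
    refine Finset.sum_lt_sum_of_nonempty (hY.image _) fun w hw => ?_
    obtain ⟨y, hy, rfl⟩ := Finset.mem_image.1 hw
    exact h y hy
  have h3 : #(Y.image S.restrict) ≤ Fintype.card V ^ #S := by
    refine (Finset.card_le_univ _).trans_eq ?_
    simp
  exact absurd (Nat.mul_le_mul_right #Y h3) (not_le.2 h2)

/-- A fibre pair of maximal weighted density is spread on the free coordinates. -/
theorem isSpread_fiber_of_forall_le [Fintype V] {F J : Finset ι} (hJ : J ⊆ F) {X Y : Finset (ι → V)}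
    {α β : ι → V} (hβ : β ∈ Y) (hV : 0 < Fintype.card V)
    (hmax : ∀ J' ⊆ F, ∀ α' ∈ X, ∀ β' ∈ Y,
      (#(fiber J' α' X) * #(fiber J' β' Y) : ℝ) * ((Fintype.card V : ℝ) ^ 2 / 2) ^ #J' ≤
        #(fiber J α X) * #(fiber J β Y) * ((Fintype.card V : ℝ) ^ 2 / 2) ^ #J) :
    IsSpread (2 / (Fintype.card V : ℝ)) (F \ J) (fiber J α X) := by
  intro S hS a
  have hV' : (0 : ℝ) < Fintype.card V := by exact_mod_cast hV
  by_cases hne : (fiber S a (fiber J α X)).Nonempty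
  swap
  · change ((#(fiber S a (fiber J α X)) : ℕ) : ℝ) ≤ _
    rw [Finset.not_nonempty_iff_eq_empty.1 hne, Finset.card_empty, Nat.cast_zero]
    positivity
  obtain ⟨α', hα'⟩ := hne
  have hYne : (fiber J β Y).Nonempty := ⟨β, mem_fiber.2 ⟨hβ, fun _ _ => rfl⟩⟩
  obtain ⟨β', hβ', hcard⟩ := exists_card_le_mul_card_fiber S hYne
  have key : ∀ (W : Finset (ι → V)) (γ γ' c : ι → V), γ' ∈ fiber S c (fiber J γ W) →
      fiber S c (fiber J γ W) = fiber (J ∪ S) γ' W := by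
    intro W γ γ' c hγ'
    simp only [mem_fiber] at hγ'
    ext x
    simp only [mem_fiber, Finset.mem_union]
    constructor
    · rintro ⟨⟨h1, h2⟩, h3⟩
      refine ⟨h1, fun i hi => ?_⟩
      rcases hi with hi | hi
      · rw [h2 i hi, hγ'.1.2 i hi]
      · rw [h3 i hi, hγ'.2 i hi]
    · rintro ⟨h1, h2⟩
      exact ⟨⟨h1, fun i hi => (h2 i (.inl hi)).trans (hγ'.1.2 i hi)⟩,
        fun i hi => (h2 i (.inr hi)).trans (hγ'.2 i hi)⟩
  have hβ'' : β' ∈ fiber S β' (fiber J β Y) := mem_fiber.2 ⟨hβ', fun _ _ => rfl⟩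
  have hm := hmax (J ∪ S) (Finset.union_subset hJ (hS.trans Finset.sdiff_subset)) α'
    (mem_fiber.1 (mem_fiber.1 hα').1).1 β' (mem_fiber.1 hβ').1
  rw [← key X α α' a hα', ← key Y β β' β' hβ'', Finset.card_union_of_disjoint
    (Finset.disjoint_of_subset_right hS Finset.disjoint_sdiff), pow_add] at hm
  change ((#(fiber S a (fiber J α X)) : ℕ) : ℝ) ≤ _
  have hcard' : (#(fiber J β Y) : ℝ) ≤
      (Fintype.card V : ℝ) ^ #S * #(fiber S β' (fiber J β Y)) := by exact_mod_cast hcard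
  set A : ℝ := (#(fiber S a (fiber J α X)) : ℝ)
  set B : ℝ := (#(fiber S β' (fiber J β Y)) : ℝ)
  set C : ℝ := (#(fiber J α X) : ℝ)
  have hY0 : (0 : ℝ) < #(fiber J β Y) := by exact_mod_cast hYne.card_pos
  set D : ℝ := (#(fiber J β Y) : ℝ)
  set N : ℝ := (Fintype.card V : ℝ)
  have hA : 0 ≤ A := Nat.cast_nonneg _
  have h1 : A * B * (N ^ 2 / 2) ^ #S ≤ C * D := by
    have h0 : (0 : ℝ) < (N ^ 2 / 2) ^ #J := by positivity
    refine le_of_mul_le_mul_right ?_ h0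
    calc _ = A * B * ((N ^ 2 / 2) ^ #J * (N ^ 2 / 2) ^ #S) := by ring
      _ ≤ _ := hm
  have h2 : A * D * (N / 2) ^ #S ≤ C * D := by
    calc A * D * (N / 2) ^ #S ≤ A * (N ^ #S * B) * (N / 2) ^ #S := by gcongr
      _ = A * B * (N ^ #S * (N / 2) ^ #S) := by ring
      _ = A * B * (N ^ 2 / 2) ^ #S := by rw [← mul_pow]; congr 2; ring
      _ ≤ _ := h1
  have h3 : A * (N / 2) ^ #S ≤ C := by
    refine le_of_mul_le_mul_right ?_ hY0
    linarith
  have h4 : (0 : ℝ) < (N / 2) ^ #S := by positivity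
  rw [← le_div_iff₀ h4] at h3
  refine h3.trans_eq ?_
  rw [← inv_div N 2, inv_pow]
  ring

/-- A dense enough rectangle contains inputs on which the gadget outputs have any prescribed
weight that is neither too small nor too large. -/
theorem exists_card_gadget_eq [Fintype V] {g : V → V → Bool} (hg : IsHadamard g) {K : ℝ} (hK : 0 < K)
    (hKV : (Fintype.card V : ℝ) = K ^ 2) {F : Finset ι} (hF : 4 * (#F : ℝ) ≤ K)
    {X Y : Finset (ι → V)} (hX : InjOnCoords F X) (hY : InjOnCoords F Y) {Δ m : ℕ}
    (hd : (Fintype.card V : ℝ) ^ (2 * #F) ≤ #X * #Y * 2 ^ Δ) (hΔm : Δ ≤ m) (hmF : m + Δ ≤ #F) :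
    ∃ x ∈ X, ∃ y ∈ Y, #{i ∈ F | g (x i) (y i) = true} = m := by
  have hV' : (0 : ℝ) < Fintype.card V := by rw [hKV]; positivity
  have hV : 0 < Fintype.card V := by exact_mod_cast hV'
  have hpos : (0 : ℝ) < #X * #Y := by
    by_contra! h
    have h1 : (0 : ℝ) < (Fintype.card V : ℝ) ^ (2 * #F) := by positivity
    have h2 : (#X * #Y : ℝ) * 2 ^ Δ ≤ 0 := mul_nonpos_of_nonpos_of_nonneg h (by positivity)
    linarith
  have hXne : X.Nonempty := by
    rw [Finset.nonempty_iff_ne_empty]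
    rintro rfl
    simp at hpos
  have hYne : Y.Nonempty := by
    rw [Finset.nonempty_iff_ne_empty]
    rintro rfl
    simp at hpos
  obtain ⟨⟨J, α, β⟩, hmem, hmax⟩ := Finset.exists_max_image (F.powerset ×ˢ X ×ˢ Y)
    (fun p => (#(fiber p.1 p.2.1 X) * #(fiber p.1 p.2.2 Y) : ℝ) *
      ((Fintype.card V : ℝ) ^ 2 / 2) ^ #p.1)
    (Finset.Nonempty.product ⟨∅, by simp⟩ (hXne.product hYne))
  simp only [Finset.mem_product, Finset.mem_powerset] at hmem
  obtain ⟨hJ, hα, hβ⟩ := hmem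
  have hmax' : ∀ J' ⊆ F, ∀ α' ∈ X, ∀ β' ∈ Y,
      (#(fiber J' α' X) * #(fiber J' β' Y) : ℝ) * ((Fintype.card V : ℝ) ^ 2 / 2) ^ #J' ≤
        #(fiber J α X) * #(fiber J β Y) * ((Fintype.card V : ℝ) ^ 2 / 2) ^ #J :=
    fun J' hJ' α' hα' β' hβ' => hmax (J', α', β') (by simp [*])
  have hJΔ : #J ≤ Δ := by
    have h0 := hmax' ∅ (by simp) α hα β hβ
    have hX0 : fiber ∅ α X = X := by ext; simp [mem_fiber]
    have hY0 : fiber ∅ β Y = Y := by ext; simp [mem_fiber]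
    rw [hX0, hY0, Finset.card_empty, pow_zero, mul_one] at h0
    have h1 : (#(fiber J α X) : ℝ) ≤ (Fintype.card V : ℝ) ^ (#F - #J) := by
      exact_mod_cast card_fiber_le hJ hX α
    have h2 : (#(fiber J β Y) : ℝ) ≤ (Fintype.card V : ℝ) ^ (#F - #J) := by
      exact_mod_cast card_fiber_le hJ hY β
    set N : ℝ := (Fintype.card V : ℝ)
    have h3 : (#X * #Y : ℝ) * 2 ^ #J ≤ N ^ (2 * #F) := by
      calc (#X * #Y : ℝ) * 2 ^ #J
          ≤ (N ^ (#F - #J) * N ^ (#F - #J) * (N ^ 2 / 2) ^ #J) * 2 ^ #J := by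
            refine mul_le_mul_of_nonneg_right (h0.trans ?_) (by positivity)
            gcongr
        _ = N ^ (#F - #J) * N ^ (#F - #J) * (N ^ 2 / 2 * 2) ^ #J := by rw [mul_pow]; ring
        _ = N ^ (2 * #F) := by
            rw [div_mul_cancel₀ _ two_ne_zero, ← pow_mul, ← pow_add, ← pow_add]
            congr 1
            have := Finset.card_le_card hJ
            omega
    have h4 : (2 : ℝ) ^ #J ≤ 2 ^ Δ := le_of_mul_le_mul_left (h3.trans hd) hpos
    exact (pow_le_pow_iff_right₀ (by norm_num)).1 h4
  have sX := isSpread_fiber_of_forall_le hJ hβ hV hmax'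
  have sY := isSpread_fiber_of_forall_le (X := Y) (Y := X) (β := α) (α := β) hJ hα hV
    fun J' hJ' α' hα' β' hβ' => by
      rw [mul_comm (#(fiber J' α' Y) : ℝ), mul_comm (#(fiber J β Y) : ℝ)]
      exact hmax' J' hJ' β' hβ' α' hα'
  rw [hKV] at sX sY
  set w := #{i ∈ J | g (α i) (β i) = true} with hw
  have hwJ : w ≤ #J := Finset.card_filter_le _ _
  have hsd := Finset.card_sdiff_of_subset hJ
  obtain ⟨T, hT, hTc⟩ := Finset.exists_subset_card_eq (s := F \ J) (n := m - w) (by omega)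
  have hFJ : 4 * (#(F \ J) : ℝ) ≤ K := by
    have : (#(F \ J) : ℝ) ≤ #F := by exact_mod_cast Finset.card_le_card Finset.sdiff_subset
    linarith
  obtain ⟨x, hx, y, hy, hxy⟩ := exists_gadget_eq_of_isSpread hg hK hKV hFJ
    ⟨α, mem_fiber.2 ⟨hα, fun _ _ => rfl⟩⟩ ⟨β, mem_fiber.2 ⟨hβ, fun _ _ => rfl⟩⟩ sX sY
    (fun i => decide (i ∈ T))
  rw [mem_fiber] at hx hy
  refine ⟨x, hx.1, y, hy.1, ?_⟩
  have : ({i ∈ F | g (x i) (y i) = true} : Finset ι) = {i ∈ J | g (α i) (β i) = true} ∪ T := by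
    ext i
    simp only [Finset.mem_filter, Finset.mem_union]
    by_cases hiJ : i ∈ J
    · have : i ∉ T := fun h => (Finset.mem_sdiff.1 (hT h)).2 hiJ
      simp [hiJ, this, hx.2 i hiJ, hy.2 i hiJ, hJ hiJ]
    · simp only [hiJ, false_and, false_or]
      constructor
      · rintro ⟨h1, h2⟩
        rw [hxy i (Finset.mem_sdiff.2 ⟨h1, hiJ⟩)] at h2
        simpa using h2
      · intro h
        have h1 := hT h
        exact ⟨(Finset.mem_sdiff.1 h1).1, by rw [hxy i h1]; simpa using h⟩
  rw [this, Finset.card_union_of_disjoint, hTc, ← hw]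
  · omega
  · rw [Finset.disjoint_left]
    exact fun i h1 h2 => (Finset.mem_sdiff.1 (hT h2)).2 (Finset.mem_filter.1 h1).1

/-- `X × Y` is either contained in one of the rectangles `A k × B k` or disjoint from all of
them. -/
def IsConstant {α β κ : Type*} (A : κ → Set α) (B : κ → Set β) (X : Finset α) (Y : Finset β) :
    Prop :=
  (∃ k, ∀ x ∈ X, ∀ y ∈ Y, x ∈ A k ∧ y ∈ B k) ∨ ∀ k, ∀ x ∈ X, ∀ y ∈ Y, ¬(x ∈ A k ∧ y ∈ B k)

/-- There is a deterministic protocol of cost `c` on `X × Y` whose leaves are constant with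
respect to the rectangles `A k × B k`. -/
def HasProtocol {α β κ : Type*} (A : κ → Set α) (B : κ → Set β) :
    ℕ → Finset α → Finset β → Prop
  | 0, X, Y => IsConstant A B X Y
  | c + 1, X, Y =>
    (∃ X₁ X₂, (∀ x ∈ X, x ∈ X₁ ∨ x ∈ X₂) ∧ HasProtocol A B c X₁ Y ∧ HasProtocol A B c X₂ Y) ∨
      ∃ Y₁ Y₂, (∀ y ∈ Y, y ∈ Y₁ ∨ y ∈ Y₂) ∧ HasProtocol A B c X Y₁ ∧ HasProtocol A B c X Y₂

section Protocol

variable {α β κ : Type*} {A : κ → Set α} {B : κ → Set β}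

theorem IsConstant.swap {X : Finset α} {Y : Finset β} (h : IsConstant A B X Y) :
    IsConstant B A Y X := by
  rcases h with ⟨k, h⟩ | h
  · exact .inl ⟨k, fun y hy x hx => (h x hx y hy).symm⟩
  · exact .inr fun k y hy x hx h' => h k x hx y hy h'.symm

theorem HasProtocol.swap {c : ℕ} {X : Finset α} {Y : Finset β} (h : HasProtocol A B c X Y) :
    HasProtocol B A c Y X := by
  induction c generalizing X Y with
  | zero => exact IsConstant.swap h
  | succ c ih =>
    rcases h with ⟨X₁, X₂, hs, h₁, h₂⟩ | ⟨Y₁, Y₂, hs, h₁, h₂⟩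
    · exact .inr ⟨X₁, X₂, hs, ih h₁, ih h₂⟩
    · exact .inl ⟨Y₁, Y₂, hs, ih h₁, ih h₂⟩

theorem HasProtocol.mono {c : ℕ} {X X' : Finset α} {Y Y' : Finset β}
    (h : HasProtocol A B c X Y) (hX : X' ⊆ X) (hY : Y' ⊆ Y) : HasProtocol A B c X' Y' := by
  induction c generalizing X X' Y Y' with
  | zero =>
    rcases h with ⟨k, h⟩ | h
    · exact .inl ⟨k, fun x hx y hy => h x (hX hx) y (hY hy)⟩
    · exact .inr fun k x hx y hy => h k x (hX hx) y (hY hy)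
  | succ c ih =>
    rcases h with ⟨X₁, X₂, hs, h₁, h₂⟩ | ⟨Y₁, Y₂, hs, h₁, h₂⟩
    · exact .inl ⟨X₁, X₂, fun x hx => hs x (hX hx), ih h₁ subset_rfl hY, ih h₂ subset_rfl hY⟩
    · exact .inr ⟨Y₁, Y₂, fun y hy => hs y (hY hy), ih h₁ hX subset_rfl, ih h₂ hX subset_rfl⟩

theorem HasProtocol.succ {c : ℕ} {X : Finset α} {Y : Finset β} (h : HasProtocol A B c X Y) :
    HasProtocol A B (c + 1) X Y :=
  .inl ⟨X, X, fun _ => .inl, h, h⟩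

theorem HasProtocol.of_le {c c' : ℕ} (hc : c ≤ c') {X : Finset α} {Y : Finset β}
    (h : HasProtocol A B c X Y) : HasProtocol A B c' X Y := by
  induction c', hc using Nat.le_induction with
  | base => exact h
  | succ _ _ ih => exact ih.succ

theorem hasProtocol_empty_left (c : ℕ) (Y : Finset β) : HasProtocol A B c ∅ Y :=
  HasProtocol.of_le (Nat.zero_le c) (.inr fun _ _ hx => absurd hx (Finset.notMem_empty _))

/-- The row player can announce one of at most `2 ^ l` cells at cost `l`. -/
theorem HasProtocol.of_cover {δ : Type*} {c l : ℕ} {X : Finset α} {Y : Finset β} {s : Finset δ}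
    (hs : #s ≤ 2 ^ l) (f : δ → Finset α) (hX : ∀ x ∈ X, ∃ d ∈ s, x ∈ f d)
    (h : ∀ d ∈ s, HasProtocol A B c (f d) Y) : HasProtocol A B (c + l) X Y := by
  induction l generalizing X s with
  | zero =>
    rw [pow_zero, Finset.card_le_one] at hs
    by_cases hne : X.Nonempty
    · obtain ⟨x, hx⟩ := hne
      obtain ⟨d, hd, -⟩ := hX x hx
      refine (h d hd).mono (fun x' hx' => ?_) subset_rfl
      obtain ⟨d', hd', hxd'⟩ := hX x' hx'
      rwa [hs d hd d' hd']
    · rw [Finset.not_nonempty_iff_eq_empty.1 hne]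
      exact hasProtocol_empty_left _ _
  | succ l ih =>
    obtain ⟨s₁, hs₁, hc₁⟩ := Finset.exists_subset_card_eq (s := s) (n := #s / 2) (by omega)
    have hc₂ := Finset.card_sdiff_of_subset hs₁
    rw [pow_succ] at hs
    refine .inl ⟨{x ∈ X | ∃ d ∈ s₁, x ∈ f d}, {x ∈ X | ∃ d ∈ s \ s₁, x ∈ f d}, ?_, ?_, ?_⟩
    · intro x hx
      obtain ⟨d, hd, hxd⟩ := hX x hx
      by_cases hd₁ : d ∈ s₁
      · exact Or.inl (Finset.mem_filter.2 ⟨hx, d, hd₁, hxd⟩)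
      · exact Or.inr
          (Finset.mem_filter.2 ⟨hx, d, Finset.mem_sdiff.2 ⟨hd, hd₁⟩, hxd⟩)
    · exact ih (s := s₁) (by omega) (fun x hx => (Finset.mem_filter.1 hx).2)
        fun d hd => h d (hs₁ hd)
    · exact ih (s := s \ s₁) (by omega) (fun x hx => (Finset.mem_filter.1 hx).2)
        fun d hd => h d (Finset.sdiff_subset hd)

/-- If few rectangles apart from `R` meet the rows of `R`, then recursing costs one more bit. -/
theorem HasProtocol.of_row_neighbors {c t : ℕ} {X : Finset α} {Y : Finset β} {S : Finset κ}
    (hS : ∀ k ∉ S, ∀ x ∈ X, ∀ y ∈ Y, ¬(x ∈ A k ∧ y ∈ B k)) {R : κ}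
    (hR : #{k ∈ S | k ≠ R ∧ ∃ x ∈ X, x ∈ A R ∧ x ∈ A k} + 1 ≤ 2 ^ t)
    (ih : ∀ {X' : Finset α} {Y' : Finset β} {S' : Finset κ}, X' ⊆ X → Y' ⊆ Y →
      (∀ k ∉ S', ∀ x ∈ X', ∀ y ∈ Y', ¬(x ∈ A k ∧ y ∈ B k)) → #S' + 1 ≤ 2 ^ t →
      HasProtocol A B c X' Y') :
    HasProtocol A B (c + 1) {x ∈ X | x ∈ A R} Y := by
  refine .inr ⟨{y ∈ Y | y ∈ B R}, {y ∈ Y | y ∉ B R}, ?_, ?_, ?_⟩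
  · intro y hy
    by_cases h : y ∈ B R
    · exact Or.inl (Finset.mem_filter.2 ⟨hy, h⟩)
    · exact Or.inr (Finset.mem_filter.2 ⟨hy, h⟩)
  · exact HasProtocol.of_le (Nat.zero_le c) (.inl ⟨R, fun x hx y hy =>
      ⟨(Finset.mem_filter.1 hx).2, (Finset.mem_filter.1 hy).2⟩⟩)
  · refine ih (Finset.filter_subset _ _) (Finset.filter_subset _ _) ?_ hR
    intro k hk x hx y hy hxy
    rw [Finset.mem_filter] at hx hy
    by_cases hkS : k ∈ S
    · refine hk (Finset.mem_filter.2 ⟨hkS, ?_, x, hx.1, hx.2, hxy.1⟩)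
      rintro rfl
      exact hy.2 hxy.2
    · exact hS k hkS x hx.1 y hy.1 hxy

/-- A partition of the ones into `r < 2 ^ l` rectangles gives a protocol of cost `O(l²)`. -/
theorem hasProtocol_of_disjoint [Fintype κ] {l : ℕ} (hl : Fintype.card κ + 1 ≤ 2 ^ l) (t : ℕ)
    {X : Finset α} {Y : Finset β} {S : Finset κ}
    (hdisj : ∀ x ∈ X, ∀ y ∈ Y, ∀ k k', x ∈ A k ∧ y ∈ B k → x ∈ A k' ∧ y ∈ B k' → k = k')
    (hS : ∀ k ∉ S, ∀ x ∈ X, ∀ y ∈ Y, ¬(x ∈ A k ∧ y ∈ B k)) (ht : #S + 1 ≤ 2 ^ t) :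
    HasProtocol A B (t * (2 * l + 1)) X Y := by
  induction t generalizing X Y S with
  | zero =>
    have : S = ∅ := by
      rw [← Finset.card_eq_zero]
      omega
    rw [zero_mul]
    exact .inr fun k => hS k (by simp [this])
  | succ t ih =>
    have ih' : ∀ {X' : Finset α} {Y' : Finset β} {S' : Finset κ}, X' ⊆ X → Y' ⊆ Y →
        (∀ k ∉ S', ∀ x ∈ X', ∀ y ∈ Y', ¬(x ∈ A k ∧ y ∈ B k)) → #S' + 1 ≤ 2 ^ t →
        HasProtocol A B (t * (2 * l + 1)) X' Y' := fun hX' hY' =>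
      ih fun x hx y hy => hdisj x (hX' hx) y (hY' hy)
    set row : κ → Finset κ := fun R => {k ∈ S | k ≠ R ∧ ∃ x ∈ X, x ∈ A R ∧ x ∈ A k}
    set col : κ → Finset κ := fun R => {k ∈ S | k ≠ R ∧ ∃ y ∈ Y, y ∈ B R ∧ y ∈ B k}
    have hrc : ∀ R ∈ S, #(row R) + 1 ≤ 2 ^ t ∨ #(col R) + 1 ≤ 2 ^ t := by
      intro R hR
      have hd : Disjoint (row R) (col R) := by
        rw [Finset.disjoint_left]
        intro k hk hk'
        simp only [row, col, Finset.mem_filter] at hk hk'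
        obtain ⟨-, hne, x, hx, hx1, hx2⟩ := hk
        obtain ⟨-, -, y, hy, hy1, hy2⟩ := hk'
        exact hne (hdisj x hx y hy k R ⟨hx2, hy2⟩ ⟨hx1, hy1⟩)
      have h1 : #(row R ∪ col R) ≤ #(S.erase R) := by
        refine Finset.card_le_card fun k hk => ?_
        simp only [row, col, Finset.mem_union, Finset.mem_filter] at hk
        rw [Finset.mem_erase]
        tauto
      rw [Finset.card_union_of_disjoint hd, Finset.card_erase_of_mem hR] at h1
      have := Finset.card_pos.2 ⟨R, hR⟩
      rw [pow_succ] at ht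
      omega
    have hcost : (t + 1) * (2 * l + 1) = t * (2 * l + 1) + 1 + l + l := by ring
    have hcard : ∀ s : Finset (Option κ), #s ≤ 2 ^ l := fun s =>
      (Finset.card_le_univ s).trans (by rwa [Fintype.card_option])
    rw [hcost]
    set XA : Option κ → Finset α := fun o => o.elim
      {x ∈ X | ∀ R ∈ S, #(row R) + 1 ≤ 2 ^ t → x ∉ A R} fun R => {x ∈ X | x ∈ A R}
    set YB : Option κ → Finset β := fun o => o.elim
      {y ∈ Y | ∀ R ∈ S, #(col R) + 1 ≤ 2 ^ t → y ∉ B R} fun R => {y ∈ Y | y ∈ B R}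
    refine HasProtocol.of_cover
      (hcard {o | ∀ R, o = some R → R ∈ S ∧ #(row R) + 1 ≤ 2 ^ t}) XA ?_ ?_
    · intro x hx
      by_cases h : ∃ R ∈ S, #(row R) + 1 ≤ 2 ^ t ∧ x ∈ A R
      · obtain ⟨R, hR, hR1, hR2⟩ := h
        exact ⟨some R, by simpa [hR] using hR1, by simp [XA, hx, hR2]⟩
      · exact ⟨none, by simp, Finset.mem_filter.2 ⟨hx, fun R hR h1 h2 => h ⟨R, hR, h1, h2⟩⟩⟩
    rintro (_ | R) hR
    · refine (HasProtocol.of_cover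
        (hcard {o | ∀ R, o = some R → R ∈ S ∧ #(col R) + 1 ≤ 2 ^ t}) YB ?_ ?_).swap
      · intro y hy
        by_cases h : ∃ R ∈ S, #(col R) + 1 ≤ 2 ^ t ∧ y ∈ B R
        · obtain ⟨R, hR, hR1, hR2⟩ := h
          exact ⟨some R, by simpa [hR] using hR1, by simp [YB, hy, hR2]⟩
        · exact ⟨none, by simp, Finset.mem_filter.2 ⟨hy, fun R hR h1 h2 => h ⟨R, hR, h1, h2⟩⟩⟩
      rintro (_ | R) hR'
      · refine HasProtocol.of_le (Nat.zero_le _) (.inr fun k y hy x hx hxy => ?_)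
        have hx' := Finset.mem_filter.1 hx
        have hy' := Finset.mem_filter.1 hy
        by_cases hk : k ∈ S
        · rcases hrc k hk with h | h
          · exact hx'.2 k hk h hxy.2
          · exact hy'.2 k hk h hxy.1
        · exact hS k hk x hx'.1 y hy'.1 hxy.symm
      · have hR1 : R ∈ S ∧ #(col R) + 1 ≤ 2 ^ t := by simpa using hR'
        refine (HasProtocol.of_row_neighbors (S := S) (t := t)
          (fun k hk y hy x hx h => hS k hk x hx y hy h.symm) hR1.2 ?_).mono subset_rfl
          (Finset.filter_subset _ _)
        intro X' Y' S' hX' hY' h1 h2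
        exact (ih' hY' hX' (fun k hk x hx y hy h => h1 k hk y hy x hx h.symm) h2).swap
    · have hR1 : R ∈ S ∧ #(row R) + 1 ≤ 2 ^ t := by simpa using hR
      refine (HasProtocol.of_row_neighbors (S := S) (t := t) hS hR1.2 ih').of_le (by omega)

end Protocol

/-- A family of pairs of sets on which the gadget vanishes identically, such that every set of
size at least `τ` is missed by at most an `η` fraction of either side of the family. -/
structure IsHitting {Ω : Type*} [Fintype Ω] (g : V → V → Bool) (U W : Ω → Set V) (τ η : ℝ) :
    Prop where
  gadget_eq_false : ∀ ω, ∀ u ∈ U ω, ∀ w ∈ W ω, g u w = false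
  card_miss_left_le : ∀ S : Finset V, τ ≤ #S → (#{ω | ∀ v ∈ S, v ∉ U ω} : ℝ) ≤ η * Fintype.card Ω
  card_miss_right_le : ∀ S : Finset V, τ ≤ #S → (#{ω | ∀ v ∈ S, v ∉ W ω} : ℝ) ≤ η * Fintype.card Ω

/-- Every element of `X` has at least `τ` variants in `X` when one coordinate of `F` is freed. -/
def IsRich (τ : ℝ) (F : Finset ι) (X : Finset (ι → V)) : Prop :=
  ∀ x ∈ X, ∀ q ∈ F, τ ≤ (#(fiber (F.erase q) x X) : ℝ)

theorem card_image_fiber_erase {F : Finset ι} {X : Finset (ι → V)} (hX : InjOnCoords F X)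
    (x : ι → V) (q : ι) :
    #((fiber (F.erase q) x X).image (· q)) = #(fiber (F.erase q) x X) := by
  refine Finset.card_image_of_injOn fun x₁ h₁ x₂ h₂ h => ?_
  rw [Finset.mem_coe, mem_fiber] at h₁ h₂
  refine hX x₁ h₁.1 x₂ h₂.1 fun i hi => ?_
  by_cases hiq : i = q
  · rw [hiq]; exact h
  · rw [h₁.2 i (Finset.mem_erase.2 ⟨hiq, hi⟩), h₂.2 i (Finset.mem_erase.2 ⟨hiq, hi⟩)]

/-- Averaging over the family: double counting the missed elements. -/
theorem sum_card_miss_le {Ω : Type*} [Fintype Ω] {U : Ω → Set V} {τ η : ℝ}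
    (hU : ∀ S : Finset V, τ ≤ #S → (#{ω | ∀ v ∈ S, v ∉ U ω} : ℝ) ≤ η * Fintype.card Ω)
    {F : Finset ι} {X X₁ : Finset (ι → V)} (hX : InjOnCoords F X) (hr : IsRich τ F X)
    (h₁ : X₁ ⊆ X) {q : ι} (hq : q ∈ F) :
    ∑ ω, (#{x ∈ X₁ | ∀ x' ∈ fiber (F.erase q) x X, x' q ∉ U ω} : ℝ) ≤
      η * Fintype.card Ω * #X₁ := by
  have h : ∑ ω, #{x ∈ X₁ | ∀ x' ∈ fiber (F.erase q) x X, x' q ∉ U ω} =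
      ∑ x ∈ X₁, #{ω | ∀ x' ∈ fiber (F.erase q) x X, x' q ∉ U ω} :=
    Finset.sum_card_bipartiteAbove_eq_sum_card_bipartiteBelow
      (s := univ) (t := X₁) fun ω x => ∀ x' ∈ fiber (F.erase q) x X, x' q ∉ U ω
  rw [← Nat.cast_sum, h, Nat.cast_sum]
  calc _ ≤ ∑ x ∈ X₁, η * Fintype.card Ω := by
        refine Finset.sum_le_sum fun x hx => ?_
        have h2 := hU ((fiber (F.erase q) x X).image (· q))
          (by rw [card_image_fiber_erase hX]; exact hr x (h₁ hx) q hq)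
        simpa only [Finset.forall_mem_image] using h2
    _ = _ := by rw [Finset.sum_const, nsmul_eq_mul, mul_comm]

/-- Replace the `q`-coordinate of the elements of `X₁` so as to land in `U`. -/
theorem exists_move {F G Q : Finset ι} {X X₁ : Finset (ι → V)} {q : ι} (hq : q ∉ G) (hGF : G ⊆ F)
    (hQF : Q ⊆ F) (hqQ : q ∉ Q) (hX₁ : InjOnCoords G X₁) (U : Set V) :
    ∃ X₂ ⊆ X, InjOnCoords G X₂ ∧
      #X₁ ≤ #X₂ + #{x ∈ X₁ | ∀ x' ∈ fiber (F.erase q) x X, x' q ∉ U} ∧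
      ∀ x₂ ∈ X₂, x₂ q ∈ U ∧ ∃ x ∈ X₁, ∀ i ∈ Q, x₂ i = x i := by
  have hex : ∀ x, ∃ x', (∃ x' ∈ fiber (F.erase q) x X, x' q ∈ U) →
      x' ∈ fiber (F.erase q) x X ∧ x' q ∈ U := by
    intro x
    by_cases h : ∃ x' ∈ fiber (F.erase q) x X, x' q ∈ U
    · obtain ⟨x', h'⟩ := h
      exact ⟨x', fun _ => h'⟩
    · exact ⟨x, fun h' => absurd h' h⟩
  choose φ hφ using hex
  set D : Finset (ι → V) := {x ∈ X₁ | ∃ x' ∈ fiber (F.erase q) x X, x' q ∈ U} with hD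
  have hφD : ∀ x ∈ D, φ x ∈ X ∧ (∀ i ∈ F.erase q, φ x i = x i) ∧ φ x q ∈ U := by
    intro x hx
    have h1 := hφ x (Finset.mem_filter.1 hx).2
    exact ⟨(mem_fiber.1 h1.1).1, (mem_fiber.1 h1.1).2, h1.2⟩
  have hG : ∀ x ∈ D, ∀ i ∈ G, φ x i = x i := fun x hx i hi =>
    (hφD x hx).2.1 i (Finset.mem_erase.2 ⟨fun h => hq (h ▸ hi), hGF hi⟩)
  have hinj : ∀ x ∈ D, ∀ x' ∈ D, (∀ i ∈ G, φ x i = φ x' i) → x = x' := fun x hx x' hx' h =>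
    hX₁ x (Finset.mem_filter.1 hx).1 x' (Finset.mem_filter.1 hx').1 fun i hi => by
      rw [← hG x hx i hi, ← hG x' hx' i hi, h i hi]
  refine ⟨D.image φ, ?_, ?_, ?_, ?_⟩
  · exact Finset.image_subset_iff.2 fun x hx => (hφD x hx).1
  · intro x hx x' hx' h
    obtain ⟨z, hz, rfl⟩ := Finset.mem_image.1 hx
    obtain ⟨z', hz', rfl⟩ := Finset.mem_image.1 hx'
    rw [hinj z hz z' hz' h]
  · rw [Finset.card_image_of_injOn fun x hx x' hx' h => hinj x hx x' hx' fun i _ => by rw [h]]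
    rw [← Finset.card_filter_add_card_filter_not (s := X₁)
      (fun x => ∃ x' ∈ fiber (F.erase q) x X, x' q ∈ U)]
    simp [hD]
  · intro x₂ hx₂
    obtain ⟨z, hz, rfl⟩ := Finset.mem_image.1 hx₂
    exact ⟨(hφD z hz).2.2, z, (Finset.mem_filter.1 hz).1, fun i hi =>
      (hφD z hz).2.1 i (Finset.mem_erase.2 ⟨fun h => hqQ (h ▸ hi), hQF hi⟩)⟩

/-- All the coordinates in `Q` can be forced to gadget value zero at a small loss. -/
theorem IsHitting.exists_gadget_eq_false {Ω : Type*} [Fintype Ω] [Nonempty Ω] {g : V → V → Bool}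
    {U W : Ω → Set V} {τ η : ℝ} (h : IsHitting g U W τ η) (hη₀ : 0 ≤ η)
    (hη : 2 * η ≤ 1) {F G : Finset ι} (hGF : G ⊆ F) {X Y X₀ Y₀ : Finset (ι → V)}
    (hX : InjOnCoords F X) (hY : InjOnCoords F Y) (hrX : IsRich τ F X) (hrY : IsRich τ F Y)
    (hX₀ : X₀ ⊆ X) (hY₀ : Y₀ ⊆ Y) (hX₀G : InjOnCoords G X₀) (hY₀G : InjOnCoords G Y₀)
    (Q : Finset ι) (hQF : Q ⊆ F) (hQG : Disjoint Q G) :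
    ∃ X₁ ⊆ X, ∃ Y₁ ⊆ Y, InjOnCoords G X₁ ∧ InjOnCoords G Y₁ ∧
      (1 - 2 * η) ^ #Q * #X₀ ≤ (#X₁ : ℝ) ∧ (1 - 2 * η) ^ #Q * #Y₀ ≤ (#Y₁ : ℝ) ∧
      ∀ x ∈ X₁, ∀ y ∈ Y₁, ∀ i ∈ Q, g (x i) (y i) = false := by
  induction Q using Finset.induction_on with
  | empty => exact ⟨X₀, hX₀, Y₀, hY₀, hX₀G, hY₀G, by simp, by simp, by simp⟩
  | insert q Q hqQ ih =>
    rw [Finset.insert_subset_iff] at hQF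
    rw [Finset.disjoint_insert_left] at hQG
    obtain ⟨X₁, hX₁, Y₁, hY₁, hX₁G, hY₁G, hcX, hcY, hz⟩ := ih hQF.2 hQG.2
    set mX : Ω → ℝ := fun ω => (#{x ∈ X₁ | ∀ x' ∈ fiber (F.erase q) x X, x' q ∉ U ω} : ℝ)
    set mY : Ω → ℝ := fun ω => (#{x ∈ Y₁ | ∀ x' ∈ fiber (F.erase q) x Y, x' q ∉ W ω} : ℝ)
    have sX : ∑ ω, mX ω ≤ η * Fintype.card Ω * #X₁ :=
      sum_card_miss_le h.card_miss_left_le hX hrX hX₁ hQF.1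
    have sY : ∑ ω, mY ω ≤ η * Fintype.card Ω * #Y₁ :=
      sum_card_miss_le h.card_miss_right_le hY hrY hY₁ hQF.1
    have hΩ : (0 : ℝ) < Fintype.card Ω := by exact_mod_cast Fintype.card_pos
    obtain ⟨ω, -, hω⟩ : ∃ ω ∈ (univ : Finset Ω), mX ω / #X₁ + mY ω / #Y₁ ≤ 2 * η := by
      refine Finset.exists_le_of_sum_le Finset.univ_nonempty ?_
      rw [Finset.sum_add_distrib, ← Finset.sum_div, ← Finset.sum_div, Finset.sum_const,
        nsmul_eq_mul, Finset.card_univ]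
      have e1 := div_le_of_le_mul₀ (Nat.cast_nonneg _) (by positivity) sX
      have e2 := div_le_of_le_mul₀ (Nat.cast_nonneg _) (by positivity) sY
      linarith
    have key : ∀ {a s t : ℝ}, 0 ≤ a ∧ a ≤ s → 0 ≤ t → a / s + t ≤ 2 * η → a ≤ 2 * η * s := by
      intro a s t ha ht hle
      rcases (ha.1.trans ha.2).eq_or_lt with rfl | hs
      · linarith
      · rw [← div_le_iff₀ hs]
        linarith
    have mX' : 0 ≤ mX ω ∧ mX ω ≤ #X₁ :=
      ⟨Nat.cast_nonneg _, Nat.cast_le.2 (Finset.card_filter_le _ _)⟩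
    have mY' : 0 ≤ mY ω ∧ mY ω ≤ #Y₁ :=
      ⟨Nat.cast_nonneg _, Nat.cast_le.2 (Finset.card_filter_le _ _)⟩
    have lX := key mX' (div_nonneg mY'.1 (Nat.cast_nonneg _)) hω
    have lY := key mY' (div_nonneg mX'.1 (Nat.cast_nonneg _)) ((add_comm _ _).trans_le hω)
    obtain ⟨X₂, hX₂, hX₂G, hX₂c, hX₂z⟩ :=
      exists_move (X := X) hQG.1 hGF hQF.2 hqQ hX₁G (U ω)
    obtain ⟨Y₂, hY₂, hY₂G, hY₂c, hY₂z⟩ :=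
      exists_move (X := Y) hQG.1 hGF hQF.2 hqQ hY₁G (W ω)
    have step : ∀ {a b c d : ℝ}, (1 - 2 * η) ^ #Q * a ≤ b → b ≤ c + d → d ≤ 2 * η * b →
        (1 - 2 * η) ^ #(insert q Q) * a ≤ c := by
      intro a b c d h1 h2 h3
      rw [Finset.card_insert_of_notMem hqQ, pow_succ]
      have h4 := mul_le_mul_of_nonneg_left h1 (sub_nonneg.2 hη)
      linarith
    refine ⟨X₂, hX₂, Y₂, hY₂, hX₂G, hY₂G, step hcX ((Nat.cast_le.2 hX₂c).trans_eq (Nat.cast_add _ _)) lX,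
      step hcY ((Nat.cast_le.2 hY₂c).trans_eq (Nat.cast_add _ _)) lY, fun x hx y hy i hi => ?_⟩
    obtain ⟨hxU, x', hx', hxx'⟩ := hX₂z x hx
    obtain ⟨hyW, y', hy', hyy'⟩ := hY₂z y hy
    rcases Finset.mem_insert.1 hi with rfl | hi
    · exact h.gadget_eq_false ω _ hxU _ hyW
    · rw [hxx' i hi, hyy' i hi]
      exact hz x' hx' y' hy' i hi

/-- The number of restrictions of elements of `X` to the coordinates in `G`. -/
noncomputable def projCard (G : Finset ι) (X : Finset (ι → V)) : ℕ := #(X.image G.restrict)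

theorem projCard_mono (G : Finset ι) {X Y : Finset (ι → V)} (h : X ⊆ Y) :
    projCard G X ≤ projCard G Y :=
  Finset.card_le_card (Finset.image_subset_image h)

theorem InjOnCoords.projCard_eq {G : Finset ι} {X : Finset (ι → V)} (h : InjOnCoords G X) :
    projCard G X = #X :=
  Finset.card_image_of_injOn fun x hx x' hx' hxx' =>
    h x hx x' hx' (restrict_eq_restrict_iff.1 hxx')

theorem projCard_pos (G : Finset ι) {X : Finset (ι → V)} (h : X.Nonempty) : 0 < projCard G X :=
  (h.image _).card_pos

theorem projCard_le_pow [Fintype V] (G : Finset ι) (X : Finset (ι → V)) :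
    projCard G X ≤ Fintype.card V ^ #G :=
  (Finset.card_le_univ _).trans_eq (by simp)

theorem projCard_le_mul_projCard_erase [Fintype V] {G : Finset ι} {j : ι} (hj : j ∈ G)
    (X : Finset (ι → V)) : projCard G X ≤ Fintype.card V * projCard (G.erase j) X := by
  have h : ∀ w ∈ X.image G.restrict, (Finset.restrict₂ (π := fun _ => V) (Finset.erase_subset j G) w, w ⟨j, hj⟩) ∈
      X.image (G.erase j).restrict ×ˢ (univ : Finset V) := by
    intro w hw
    obtain ⟨x, hx, rfl⟩ := Finset.mem_image.1 hw
    exact Finset.mem_product.2 ⟨Finset.mem_image.2 ⟨x, hx, rfl⟩, Finset.mem_univ _⟩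
  have := Finset.card_le_card_of_injOn _ h ?_
  · rwa [Finset.card_product, Finset.card_univ, mul_comm] at this
  · intro w _ w' _ hww'
    rw [Prod.mk.injEq] at hww'
    funext i
    by_cases hi : i.1 = j
    · have : i = ⟨j, hj⟩ := Subtype.ext hi
      rw [this]
      exact hww'.2
    · exact congrFun hww'.1 ⟨i.1, Finset.mem_erase.2 ⟨hi, i.2⟩⟩

theorem exists_transversal (G : Finset ι) (X : Finset (ι → V)) :
    ∃ X₀ ⊆ X, InjOnCoords G X₀ ∧ #X₀ = projCard G X := by
  obtain ⟨X₀, h1, h2, h3⟩ := Finset.exists_subset_injOn_image_eq_of_surjOn X (X.image G.restrict)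
    (f := G.restrict) (by rw [Finset.coe_image]; exact Set.surjOn_image _ _)
  refine ⟨X₀, h1, fun x hx x' hx' h => h2 hx hx' (restrict_eq_restrict_iff.2 h), ?_⟩
  rw [projCard, ← h3, Finset.card_image_of_injOn h2]

/-- Every coordinate of `F` takes at least `c` values on average, given the others. -/
def IsThick (c : ℝ) (F : Finset ι) (X : Finset (ι → V)) : Prop :=
  ∀ j ∈ F, c * projCard (F.erase j) X ≤ #X

/-- Pruning a thick set yields a rich subset of at least half the size. -/
theorem IsThick.exists_isRich {τ c : ℝ} (hτ : 0 ≤ τ) {F : Finset ι} (hc : 2 * τ * #F ≤ c)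
    {X : Finset (ι → V)} (hX : IsThick c F X) : ∃ Z ⊆ X, #X ≤ 2 * #Z ∧ IsRich τ F Z := by
  obtain ⟨Z, hZX, hmax⟩ := Finset.exists_max_image X.powerset
    (fun Z => (#Z : ℝ) - τ * ∑ j ∈ F, (projCard (F.erase j) Z : ℝ)) ⟨∅, by simp⟩
  rw [Finset.mem_powerset] at hZX
  refine ⟨Z, hZX, ?_, ?_⟩
  · have h1 := hmax X (by simp)
    have h2 : (0 : ℝ) ≤ τ * ∑ j ∈ F, (projCard (F.erase j) Z : ℝ) := by positivity
    have h3 : 2 * (τ * ∑ j ∈ F, (projCard (F.erase j) X : ℝ)) ≤ #X := by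
      rcases F.eq_empty_or_nonempty with rfl | hF
      · simp
      have hF' : (0 : ℝ) < #F := by exact_mod_cast hF.card_pos
      refine le_of_mul_le_mul_left ?_ hF'
      calc _ = ∑ j ∈ F, 2 * τ * #F * (projCard (F.erase j) X : ℝ) := by
            rw [← Finset.mul_sum]; ring
        _ ≤ ∑ j ∈ F, (#X : ℝ) := Finset.sum_le_sum fun j hj =>
            (mul_le_mul_of_nonneg_right hc (Nat.cast_nonneg _)).trans (hX j hj)
        _ = #F * #X := by rw [Finset.sum_const, nsmul_eq_mul]
    have h4 : (#X : ℝ) ≤ 2 * #Z := by linarith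
    exact_mod_cast h4
  · intro x hx q hq
    set D := fiber (F.erase q) x Z with hD
    have hDZ : D ⊆ Z := Finset.filter_subset _ _
    have h1 := hmax (Z \ D) (by simpa using Finset.sdiff_subset.trans hZX)
    rw [Finset.cast_card_sdiff hDZ, ← Finset.add_sum_erase _ _ hq,
      ← Finset.add_sum_erase F (fun j => (projCard (F.erase j) Z : ℝ)) hq] at h1
    have h2 : (projCard (F.erase q) (Z \ D) : ℝ) + 1 ≤ projCard (F.erase q) Z := by
      have : projCard (F.erase q) (Z \ D) < projCard (F.erase q) Z := by
        refine Finset.card_lt_card (Finset.ssubset_iff_of_subset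
          (Finset.image_subset_image Finset.sdiff_subset) |>.2
          ⟨(F.erase q).restrict x, Finset.mem_image_of_mem _ hx, fun h => ?_⟩)
        obtain ⟨x', hx', hxx'⟩ := Finset.mem_image.1 h
        rw [Finset.mem_sdiff] at hx'
        exact hx'.2 (Finset.mem_filter.2 ⟨hx'.1, hxx'⟩)
      exact_mod_cast this
    have h3 : ∑ j ∈ F.erase q, (projCard (F.erase j) (Z \ D) : ℝ) ≤
        ∑ j ∈ F.erase q, (projCard (F.erase j) Z : ℝ) := Finset.sum_le_sum fun j _ =>
      Nat.cast_le.2 (projCard_mono _ Finset.sdiff_subset)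
    have h4 := mul_le_mul_of_nonneg_left (add_le_add h2 h3) hτ
    linarith

/-- The density of a rectangle on the coordinates `G`, weighted to favour more coordinates. -/
noncomputable def potential (N : ℝ) (G : Finset ι) (X Y : Finset (ι → V)) : ℝ :=
  projCard G X * projCard G Y * (2 / N ^ 2) ^ #G

theorem exists_max_potential [Fintype V] (hV : 0 < Fintype.card V) (F : Finset ι)
    {X Y : Finset (ι → V)} (hX : X.Nonempty) (hY : Y.Nonempty) :
    ∃ G ⊆ F, potential (Fintype.card V) F X Y ≤ potential (Fintype.card V) G X Y ∧
      (∀ j ∈ G, (Fintype.card V : ℝ) / 2 * projCard (G.erase j) X ≤ projCard G X) ∧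
      ∀ j ∈ G, (Fintype.card V : ℝ) / 2 * projCard (G.erase j) Y ≤ projCard G Y := by
  obtain ⟨G, hG, hmax⟩ := Finset.exists_max_image F.powerset
    (fun G => potential (Fintype.card V) G X Y) ⟨∅, by simp⟩
  rw [Finset.mem_powerset] at hG
  have hN : (0 : ℝ) < Fintype.card V := by exact_mod_cast hV
  set N : ℝ := (Fintype.card V : ℝ)
  have key : ∀ {a a' b b' : ℝ}, ∀ j ∈ G, 0 < b' → 0 ≤ a → b ≤ N * b' →
      a' * b' * (2 / N ^ 2) ^ #(G.erase j) ≤ a * b * (2 / N ^ 2) ^ #G → N / 2 * a' ≤ a := by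
    intro a a' b b' j hj hb' ha hb h
    rw [← Finset.card_erase_add_one hj, pow_succ _ #(G.erase j)] at h
    have h1 : a' * b' ≤ a * b * (2 / N ^ 2) := by
      refine le_of_mul_le_mul_right ?_ (show (0 : ℝ) < (2 / N ^ 2) ^ #(G.erase j) by positivity)
      linarith
    have h2 : a' * b' ≤ a * (N * b') * (2 / N ^ 2) := h1.trans (by gcongr)
    have h3 : a * (N * b') * (2 / N ^ 2) = a * (2 / N) * b' := by field_simp
    rw [h3] at h2
    have h4 := le_of_mul_le_mul_right h2 hb'
    calc N / 2 * a' ≤ N / 2 * (a * (2 / N)) := by gcongr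
      _ = a := by field_simp
  refine ⟨G, hG, hmax F (by simp), fun j hj => ?_, fun j hj => ?_⟩
  · refine key j hj (b := projCard G Y) (b' := projCard (G.erase j) Y)
      (by exact_mod_cast projCard_pos _ hY) (by positivity)
      ((Nat.cast_le.2 (projCard_le_mul_projCard_erase hj Y)).trans_eq (Nat.cast_mul _ _))
      (hmax (G.erase j) (Finset.mem_powerset.2 ((Finset.erase_subset _ _).trans hG)))
  · refine key j hj (b := projCard G X) (b' := projCard (G.erase j) X)
      (by exact_mod_cast projCard_pos _ hX) (by positivity)
      ((Nat.cast_le.2 (projCard_le_mul_projCard_erase hj X)).trans_eq (Nat.cast_mul _ _)) ?_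
    have := hmax (G.erase j) (Finset.mem_powerset.2 ((Finset.erase_subset _ _).trans hG))
    simp only [potential] at this
    linarith

/-- The invariant of the simulation: the gadget is settled to zero outside `F`, and both sides
have many values on every coordinate of `F`. -/
structure IsState [Fintype V] (g : V → V → Bool) (F : Finset ι) (X Y : Finset (ι → V)) :
    Prop where
  inj_left : InjOnCoords F X
  inj_right : InjOnCoords F Y
  gadget_eq_false : ∀ x ∈ X, ∀ y ∈ Y, ∀ i ∉ F, g (x i) (y i) = false
  thick_left : IsThick ((Fintype.card V : ℝ) / 4) F X
  thick_right : IsThick ((Fintype.card V : ℝ) / 4) F Y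

theorem InjOnCoords.mono {F : Finset ι} {X Y : Finset (ι → V)} (h : InjOnCoords F Y)
    (hXY : X ⊆ Y) : InjOnCoords F X :=
  fun x hx x' hx' => h x (hXY hx) x' (hXY hx')

theorem IsThick.mono {c c' : ℝ} (hc : c' ≤ c) {F : Finset ι} {X : Finset (ι → V)}
    (h : IsThick c F X) : IsThick c' F X :=
  fun j hj => (mul_le_mul_of_nonneg_right hc (Nat.cast_nonneg _)).trans (h j hj)

theorem IsThick.of_le_two_mul {c : ℝ} (hc : 0 ≤ c) {F : Finset ι} {X X₁ : Finset (ι → V)}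
    (h : IsThick c F X) (hX : X₁ ⊆ X) (hcard : #X ≤ 2 * #X₁) : IsThick (c / 2) F X₁ := by
  intro j hj
  have h1 : (projCard (F.erase j) X₁ : ℝ) ≤ projCard (F.erase j) X :=
    Nat.cast_le.2 (projCard_mono _ hX)
  have h2 : (#X : ℝ) ≤ 2 * #X₁ := by exact_mod_cast hcard
  have h3 := mul_le_mul_of_nonneg_left h1 hc
  have h4 := h j hj
  linarith

section Simulation

variable [Fintype ι] [Fintype V] {Ω : Type*} [Fintype Ω] [Nonempty Ω] {g : V → V → Bool}
  {U W : Ω → Set V} {τ η : ℝ}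

theorem three_quarters_le_pow (hη₀ : 0 ≤ η) (hη : 8 * η * Fintype.card ι ≤ 1) (Q : Finset ι) :
    3 / 4 ≤ (1 - 2 * η) ^ #Q := by
  rcases Q.eq_empty_or_nonempty with rfl | hQ
  · norm_num
  have h1 : (1 : ℝ) ≤ #Q := by exact_mod_cast hQ.card_pos
  have h2 : (#Q : ℝ) ≤ Fintype.card ι := by exact_mod_cast Finset.card_le_univ Q
  have h3 : 8 * η * #Q ≤ 1 := (mul_le_mul_of_nonneg_left h2 (by positivity)).trans hη
  have h4 : η ≤ η * #Q := le_mul_of_one_le_right hη₀ h1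
  have := one_add_mul_le_pow (a := -(2 * η)) (by linarith) #Q
  rw [← sub_eq_add_neg] at this
  linarith

theorem two_mul_mul_card_le {N : ℝ} (hτ : 0 ≤ τ) (hτN : 16 * τ * Fintype.card ι ≤ N)
    (F : Finset ι) : 2 * τ * #F ≤ N / 8 := by
  have h : (#F : ℝ) ≤ Fintype.card ι := by exact_mod_cast Finset.card_le_univ F
  have := mul_le_mul_of_nonneg_left h hτ
  linarith

/-- Refresh the invariant after one side has been halved. -/
theorem IsHitting.exists_isState (h : IsHitting g U W τ η) (hτ : 0 ≤ τ)
    (hτN : 16 * τ * Fintype.card ι ≤ Fintype.card V) (hη₀ : 0 ≤ η) (hη : 2 * η ≤ 1)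
    (hηι : 8 * η * Fintype.card ι ≤ 1) (hV : 0 < Fintype.card V) {F : Finset ι}
    {X Y : Finset (ι → V)} (hXne : X.Nonempty) (hYne : Y.Nonempty) (hX : InjOnCoords F X)
    (hY : InjOnCoords F Y) (hz : ∀ x ∈ X, ∀ y ∈ Y, ∀ i ∉ F, g (x i) (y i) = false)
    (tX : IsThick ((Fintype.card V : ℝ) / 8) F X) (tY : IsThick ((Fintype.card V : ℝ) / 8) F Y) :
    ∃ G ⊆ F, ∃ X' ⊆ X, ∃ Y' ⊆ Y, X'.Nonempty ∧ Y'.Nonempty ∧ IsState g G X' Y' ∧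
      potential (Fintype.card V) F X Y ≤ 8 * potential (Fintype.card V) G X' Y' := by
  obtain ⟨Z, hZX, hZc, hZr⟩ := tX.exists_isRich hτ (two_mul_mul_card_le hτ hτN F)
  obtain ⟨T, hTY, hTc, hTr⟩ := tY.exists_isRich hτ (two_mul_mul_card_le hτ hτN F)
  have hZne : Z.Nonempty := by
    rw [← Finset.card_pos] at hXne ⊢
    omega
  have hTne : T.Nonempty := by
    rw [← Finset.card_pos] at hYne ⊢
    omega
  have hN : (0 : ℝ) < Fintype.card V := by exact_mod_cast hV
  obtain ⟨G, hG, hpot, hGZ, hGT⟩ := exists_max_potential hV F hZne hTne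
  obtain ⟨Z₀, hZ₀, hZ₀i, hZ₀c⟩ := exists_transversal G Z
  obtain ⟨T₀, hT₀, hT₀i, hT₀c⟩ := exists_transversal G T
  obtain ⟨X', hX', Y', hY', hX'i, hY'i, hX'c, hY'c, hz'⟩ :=
    h.exists_gadget_eq_false hη₀ hη hG (hX.mono hZX) (hY.mono hTY) hZr hTr hZ₀ hT₀ hZ₀i hT₀i
      (F \ G) Finset.sdiff_subset Finset.sdiff_disjoint
  rw [hZ₀c] at hX'c
  rw [hT₀c] at hY'c
  have hq := three_quarters_le_pow hη₀ hηι (F \ G)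
  have cX : 3 / 4 * (projCard G Z : ℝ) ≤ #X' :=
    (mul_le_mul_of_nonneg_right hq (Nat.cast_nonneg _)).trans hX'c
  have cY : 3 / 4 * (projCard G T : ℝ) ≤ #Y' :=
    (mul_le_mul_of_nonneg_right hq (Nat.cast_nonneg _)).trans hY'c
  have pZ : (0 : ℝ) < projCard G Z := by exact_mod_cast projCard_pos G hZne
  have pT : (0 : ℝ) < projCard G T := by exact_mod_cast projCard_pos G hTne
  have thick : ∀ {Z X' : Finset (ι → V)}, X' ⊆ Z → 3 / 4 * (projCard G Z : ℝ) ≤ #X' →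
      (∀ j ∈ G, (Fintype.card V : ℝ) / 2 * projCard (G.erase j) Z ≤ projCard G Z) →
      IsThick ((Fintype.card V : ℝ) / 4) G X' := by
    intro Z X' hX'Z hc hmax j hj
    have h1 : (projCard (G.erase j) X' : ℝ) ≤ projCard (G.erase j) Z :=
      Nat.cast_le.2 (projCard_mono _ hX'Z)
    have h2 := mul_le_mul_of_nonneg_left h1 hN.le
    have h3 := hmax j hj
    have h4 : (0 : ℝ) ≤ projCard G Z := Nat.cast_nonneg _
    linarith
  refine ⟨G, hG, X', hX'.trans hZX, Y', hY'.trans hTY, ?_, ?_, ⟨hX'i, hY'i, ?_,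
    thick hX' cX hGZ, thick hY' cY hGT⟩, ?_⟩
  · rw [← Finset.card_pos]
    have : (0 : ℝ) < #X' := by linarith
    exact_mod_cast this
  · rw [← Finset.card_pos]
    have : (0 : ℝ) < #Y' := by linarith
    exact_mod_cast this
  · intro x hx y hy i hi
    by_cases hiF : i ∈ F
    · exact hz' x hx y hy i (Finset.mem_sdiff.2 ⟨hiF, hi⟩)
    · exact hz x (hZX (hX' hx)) y (hTY (hY' hy)) i hiF
  · have e1 : potential (Fintype.card V) F X Y ≤ 4 * potential (Fintype.card V) F Z T := by
      simp only [potential]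
      rw [hX.projCard_eq, hY.projCard_eq, (hX.mono hZX).projCard_eq, (hY.mono hTY).projCard_eq]
      have a1 : (#X : ℝ) ≤ 2 * #Z := by exact_mod_cast hZc
      have a2 : (#Y : ℝ) ≤ 2 * #T := by exact_mod_cast hTc
      calc (#X * #Y * (2 / (Fintype.card V : ℝ) ^ 2) ^ #F : ℝ)
          ≤ (2 * #Z) * (2 * #T) * (2 / (Fintype.card V : ℝ) ^ 2) ^ #F := by gcongr
        _ = _ := by ring
    have e2 : potential (Fintype.card V) G Z T ≤ 2 * potential (Fintype.card V) G X' Y' := by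
      simp only [potential]
      rw [hX'i.projCard_eq, hY'i.projCard_eq]
      have a1 : (3 / 4 * (projCard G Z : ℝ)) * (3 / 4 * projCard G T) ≤ #X' * #Y' := by gcongr
      have a2 : (projCard G Z : ℝ) * projCard G T ≤ 2 * (#X' * #Y') := by
        have : 0 < (projCard G Z : ℝ) * projCard G T := by positivity
        linarith
      rw [← mul_assoc]
      exact mul_le_mul_of_nonneg_right a2 (by positivity)
    linarith

/-- Follow the protocol to a leaf while maintaining the invariant. -/
theorem IsHitting.exists_isConstant (h : IsHitting g U W τ η) (hτ : 0 ≤ τ)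
    (hτN : 16 * τ * Fintype.card ι ≤ Fintype.card V) (hη₀ : 0 ≤ η) (hη : 2 * η ≤ 1)
    (hηι : 8 * η * Fintype.card ι ≤ 1) (hV : 0 < Fintype.card V) {κ : Type*}
    {A B : κ → Set (ι → V)} {c : ℕ} {F : Finset ι} {X Y : Finset (ι → V)}
    (hXne : X.Nonempty) (hYne : Y.Nonempty) (hs : IsState g F X Y) (hp : HasProtocol A B c X Y) :
    ∃ (G : Finset ι) (X' Y' : Finset (ι → V)), X'.Nonempty ∧ Y'.Nonempty ∧ IsState g G X' Y' ∧
      IsConstant A B X' Y' ∧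
      potential (Fintype.card V) F X Y ≤ 16 ^ c * potential (Fintype.card V) G X' Y' := by
  induction c generalizing F X Y with
  | zero => exact ⟨F, X, Y, hXne, hYne, hs, hp, by simp⟩
  | succ c ih =>
    have step : ∀ {X₁ Y₁ : Finset (ι → V)}, X₁ ⊆ X → Y₁ ⊆ Y → #X ≤ 2 * #X₁ → #Y ≤ 2 * #Y₁ →
        #X * #Y ≤ 2 * (#X₁ * #Y₁) → HasProtocol A B c X₁ Y₁ →
        ∃ (G : Finset ι) (X' Y' : Finset (ι → V)), X'.Nonempty ∧ Y'.Nonempty ∧ IsState g G X' Y' ∧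
          IsConstant A B X' Y' ∧ potential (Fintype.card V) F X Y ≤
            16 ^ (c + 1) * potential (Fintype.card V) G X' Y' := by
      intro X₁ Y₁ hX₁ hY₁ hcX hcY hc hp₁
      have eighth : (Fintype.card V : ℝ) / 4 / 2 = Fintype.card V / 8 := by ring
      have hX₁ne : X₁.Nonempty := by
        rw [← Finset.card_pos] at hXne ⊢
        omega
      have hY₁ne : Y₁.Nonempty := by
        rw [← Finset.card_pos] at hYne ⊢
        omega
      have hiX := hs.inj_left.mono hX₁
      have hiY := hs.inj_right.mono hY₁
      obtain ⟨G, -, X', hX', Y', hY', hX'ne, hY'ne, hs', hpot⟩ :=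
        h.exists_isState hτ hτN hη₀ hη hηι hV hX₁ne hY₁ne hiX hiY
          (fun x hx y hy => hs.gadget_eq_false x (hX₁ hx) y (hY₁ hy))
          (eighth ▸ hs.thick_left.of_le_two_mul (by positivity) hX₁ hcX)
          (eighth ▸ hs.thick_right.of_le_two_mul (by positivity) hY₁ hcY)
      obtain ⟨G', X'', Y'', h1, h2, h3, h4, h5⟩ := ih hX'ne hY'ne hs' (hp₁.mono hX' hY')
      have e : potential (Fintype.card V) F X Y ≤ 2 * potential (Fintype.card V) F X₁ Y₁ := by
        have hc' : (#X * #Y : ℝ) ≤ 2 * (#X₁ * #Y₁) := by exact_mod_cast hc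
        simp only [potential]
        rw [hs.inj_left.projCard_eq, hs.inj_right.projCard_eq, hiX.projCard_eq, hiY.projCard_eq,
          ← mul_assoc]
        exact mul_le_mul_of_nonneg_right hc' (by positivity)
      exact ⟨G', X'', Y'', h1, h2, h3, h4, by rw [pow_succ]; linarith⟩
    have half : ∀ {X X₁ X₂ : Finset (ι → V)}, (∀ x ∈ X, x ∈ X₁ ∨ x ∈ X₂) →
        #X ≤ 2 * #(X ∩ X₁) ∨ #X ≤ 2 * #(X ∩ X₂) := by
      intro X X₁ X₂ hX
      have h1 := Finset.card_union_le (X ∩ X₁) (X ∩ X₂)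
      rw [← Finset.inter_union_distrib_left,
        Finset.inter_eq_left.2 fun x hx => Finset.mem_union.2 (hX x hx)] at h1
      omega
    have goX : ∀ X₁, HasProtocol A B c X₁ Y → #X ≤ 2 * #(X ∩ X₁) → _ := fun X₁ hp₁ hc =>
      step Finset.inter_subset_left subset_rfl hc (by omega)
        ((Nat.mul_le_mul_right _ hc).trans_eq (mul_assoc _ _ _))
        (hp₁.mono Finset.inter_subset_right subset_rfl)
    have goY : ∀ Y₁, HasProtocol A B c X Y₁ → #Y ≤ 2 * #(Y ∩ Y₁) → _ := fun Y₁ hp₁ hc =>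
      step subset_rfl Finset.inter_subset_left (by omega) hc
        ((Nat.mul_le_mul_left _ hc).trans_eq (mul_left_comm _ _ _))
        (hp₁.mono subset_rfl Finset.inter_subset_right)
    rcases hp with ⟨X₁, X₂, hsub, h₁, h₂⟩ | ⟨Y₁, Y₂, hsub, h₁, h₂⟩
    · exact (half hsub).elim (goX X₁ h₁) (goX X₂ h₂)
    · exact (half hsub).elim (goY Y₁ h₁) (goY Y₂ h₂)

end Simulation

section Separation

variable [Fintype ι] [Fintype V] {Ω : Type*} [Fintype Ω] [Nonempty Ω] {g : V → V → Bool}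
  {U W : Ω → Set V} {τ η : ℝ}

/-- A rectangle satisfying the invariant contains an input pair all of whose gadgets are zero. -/
theorem IsHitting.exists_forall_gadget_eq_false (h : IsHitting g U W τ η) (hτ : 0 ≤ τ)
    (hτN : 16 * τ * Fintype.card ι ≤ Fintype.card V) (hη₀ : 0 ≤ η) (hη : 2 * η ≤ 1)
    (hηι : 8 * η * Fintype.card ι ≤ 1) {F : Finset ι} {X Y : Finset (ι → V)}
    (hXne : X.Nonempty) (hYne : Y.Nonempty) (hs : IsState g F X Y) :
    ∃ x ∈ X, ∃ y ∈ Y, ∀ i, g (x i) (y i) = false := by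
  have hN : (0 : ℝ) ≤ Fintype.card V := Nat.cast_nonneg _
  have hF : 2 * τ * #F ≤ (Fintype.card V : ℝ) / 4 :=
    (two_mul_mul_card_le hτ hτN F).trans (by linarith)
  obtain ⟨Z, hZX, hZc, hZr⟩ := hs.thick_left.exists_isRich hτ hF
  obtain ⟨T, hTY, hTc, hTr⟩ := hs.thick_right.exists_isRich hτ hF
  obtain ⟨x₀, hx₀⟩ : Z.Nonempty := by
    rw [← Finset.card_pos] at hXne ⊢
    omega
  obtain ⟨y₀, hy₀⟩ : T.Nonempty := by
    rw [← Finset.card_pos] at hYne ⊢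
    omega
  have hsing : ∀ x : ι → V, InjOnCoords ∅ {x} := fun x a ha b hb _ =>
    (Finset.mem_singleton.1 ha).trans (Finset.mem_singleton.1 hb).symm
  obtain ⟨X₁, hX₁, Y₁, hY₁, -, -, hcX, hcY, hz⟩ :=
    h.exists_gadget_eq_false hη₀ hη (Finset.empty_subset F) (hs.inj_left.mono hZX)
      (hs.inj_right.mono hTY) hZr hTr (Finset.singleton_subset_iff.2 hx₀)
      (Finset.singleton_subset_iff.2 hy₀) (hsing x₀) (hsing y₀) F subset_rfl
      (Finset.disjoint_empty_right F)
  have hq := three_quarters_le_pow hη₀ hηι F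
  have ne : ∀ {a : ι → V} {X₁ : Finset (ι → V)},
      (1 - 2 * η) ^ #F * #({a} : Finset (ι → V)) ≤ (#X₁ : ℝ) → X₁.Nonempty := by
    intro a X₁ hc
    rw [Finset.card_singleton, Nat.cast_one, mul_one] at hc
    rw [← Finset.card_pos]
    have : (0 : ℝ) < #X₁ := by linarith
    exact_mod_cast this
  obtain ⟨x, hx⟩ := ne hcX
  obtain ⟨y, hy⟩ := ne hcY
  refine ⟨x, hZX (hX₁ hx), y, hTY (hY₁ hy), fun i => ?_⟩
  by_cases hi : i ∈ F
  · exact hz x hx y hy i hi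
  · exact hs.gadget_eq_false x (hZX (hX₁ hx)) y (hTY (hY₁ hy)) i hi

/-- A rectangle of large potential contains an input pair of gadget weight `m`. -/
theorem IsState.exists_card_gadget_eq_of_potential (hg : IsHadamard g) {K : ℝ} (hK : 0 < K)
    (hKV : (Fintype.card V : ℝ) = K ^ 2) (hι : 4 * (Fintype.card ι : ℝ) ≤ K) {F : Finset ι}
    {X Y : Finset (ι → V)} (hs : IsState g F X Y) {c m : ℕ} (hm : 2 * m = Fintype.card ι)
    (hc : 2 * (4 * c + 1) ≤ m)
    (hpot : 9 / 16 * 2 ^ Fintype.card ι ≤ 16 ^ c * potential (Fintype.card V) F X Y) :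
    ∃ x ∈ X, ∃ y ∈ Y, #{i | g (x i) (y i) = true} = m := by
  have hN : (0 : ℝ) < Fintype.card V := by rw [hKV]; positivity
  have hFι : #F ≤ Fintype.card ι := Finset.card_le_univ F
  have hX : (#X : ℝ) ≤ (Fintype.card V : ℝ) ^ #F := by
    rw [← hs.inj_left.projCard_eq]
    exact_mod_cast projCard_le_pow F X
  have hY : (#Y : ℝ) ≤ (Fintype.card V : ℝ) ^ #F := by
    rw [← hs.inj_right.projCard_eq]
    exact_mod_cast projCard_le_pow F Y
  have hF4 : 4 * (#F : ℝ) ≤ K := by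
    have : (#F : ℝ) ≤ Fintype.card ι := by exact_mod_cast hFι
    linarith
  have hP : potential (Fintype.card V) F X Y * (Fintype.card V : ℝ) ^ (2 * #F) =
      #X * #Y * 2 ^ #F := by
    rw [potential, hs.inj_left.projCard_eq, hs.inj_right.projCard_eq, pow_mul, mul_assoc,
      ← mul_pow, div_mul_cancel₀ _ (by positivity)]
  have hN2 : (0 : ℝ) < (Fintype.card V : ℝ) ^ (2 * #F) := by positivity
  have h16 : (16 : ℝ) ^ c * 2 = 2 ^ (4 * c + 1) := by
    rw [pow_succ, pow_mul]; norm_num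
  have hle : Fintype.card ι ≤ 4 * c + 1 + #F := by
    have h1 : potential (Fintype.card V) F X Y ≤ 2 ^ #F := by
      refine le_of_mul_le_mul_right ?_ hN2
      rw [hP, mul_comm]
      refine mul_le_mul_of_nonneg_left ?_ (by positivity)
      calc (#X * #Y : ℝ) ≤ (Fintype.card V : ℝ) ^ #F * (Fintype.card V : ℝ) ^ #F := by gcongr
        _ = _ := by rw [← pow_add, two_mul]
    have h2 : (16 : ℝ) ^ c * potential (Fintype.card V) F X Y ≤ 16 ^ c * 2 ^ #F := by gcongr
    have h3 : (2 : ℝ) ^ Fintype.card ι ≤ 2 ^ (4 * c + 1 + #F) := by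
      rw [pow_add _ (4 * c + 1), ← h16]
      have : (0 : ℝ) < 16 ^ c * 2 ^ #F := by positivity
      linarith
    exact (pow_le_pow_iff_right₀ (by norm_num)).1 h3
  have hd : (Fintype.card V : ℝ) ^ (2 * #F) ≤ #X * #Y * 2 ^ (4 * c + 1) := by
    have h2 : (2 : ℝ) ^ #F ≤ 2 ^ Fintype.card ι := pow_le_pow_right₀ (by norm_num) hFι
    refine le_of_mul_le_mul_right ?_ (show (0 : ℝ) < 2 ^ #F by positivity)
    have h3 : 9 / 16 * (2 : ℝ) ^ #F * (Fintype.card V : ℝ) ^ (2 * #F) ≤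
        16 ^ c * potential (Fintype.card V) F X Y * (Fintype.card V : ℝ) ^ (2 * #F) :=
      mul_le_mul_of_nonneg_right (by linarith) hN2.le
    rw [mul_assoc ((16 : ℝ) ^ c), hP] at h3
    rw [← h16]
    have : (0 : ℝ) ≤ 16 ^ c * (#X * #Y * 2 ^ #F) := by positivity
    linarith
  obtain ⟨x, hx, y, hy, hxy⟩ := exists_card_gadget_eq hg hK hKV hF4 hs.inj_left
    hs.inj_right hd (m := m) (by omega) (by omega)
  refine ⟨x, hx, y, hy, ?_⟩
  rw [← hxy]
  congr 1
  ext i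
  simp only [Finset.mem_filter, Finset.mem_univ, true_and]
  refine ⟨fun h => ⟨?_, h⟩, fun h => h.2⟩
  by_contra hi
  rw [hs.gadget_eq_false x hx y hy i hi] at h
  exact Bool.false_ne_true h

/-- Most points lie outside a few small sets. -/
theorem exists_forall_notMem_of_card_mul_le {α δ : Type*} [Fintype α] [Fintype δ]
    (S : δ → Finset α) {D : ℕ} (hδ : Fintype.card δ ≤ D) :
    ∃ X : Finset α, 3 * Fintype.card α ≤ 4 * #X ∧
      ∀ e, #(S e) * (4 * D) ≤ Fintype.card α → ∀ x ∈ X, x ∉ S e := by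
  set E : Finset δ := {e | #(S e) * (4 * D) ≤ Fintype.card α} with hE
  refine ⟨univ \ E.biUnion S, ?_, fun e he x hx hxe => (Finset.mem_sdiff.1 hx).2
    (Finset.mem_biUnion.2 ⟨e, Finset.mem_filter.2 ⟨Finset.mem_univ e, he⟩, hxe⟩)⟩
  have hED : #E ≤ D := (Finset.card_le_univ E).trans hδ
  have h1 := Finset.card_sdiff_add_card_eq_card (Finset.subset_univ (E.biUnion S))
  rw [Finset.card_univ] at h1
  have h2 : #(E.biUnion S) * (4 * D) ≤ D * Fintype.card α := by
    calc _ ≤ (∑ e ∈ E, #(S e)) * (4 * D) := Nat.mul_le_mul_right _ Finset.card_biUnion_le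
      _ = ∑ e ∈ E, #(S e) * (4 * D) := Finset.sum_mul _ _ _
      _ ≤ ∑ e ∈ E, Fintype.card α := Finset.sum_le_sum fun e he => (Finset.mem_filter.1 he).2
      _ = #E * Fintype.card α := by rw [Finset.sum_const, smul_eq_mul]
      _ ≤ _ := Nat.mul_le_mul_right _ hED
  have h3 : #(E.biUnion S) * 4 ≤ Fintype.card α := by
    rcases Nat.eq_zero_or_pos D with rfl | hD
    · rw [Finset.card_eq_zero.1 (Nat.le_zero.1 hED)]
      simp
    · refine Nat.le_of_mul_le_mul_left ?_ hD
      linarith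
  omega

/-- A rectangle without entries of gadget weight `m` has a small side. -/
theorem card_mul_le_or_card_mul_le (hg : IsHadamard g) {K : ℝ} (hK : 0 < K)
    (hKV : (Fintype.card V : ℝ) = K ^ 2) (hι : 4 * (Fintype.card ι : ℝ) ≤ K) {l m D : ℕ}
    (hD : D = 2 ^ (2 * l)) (hm : 2 * m = Fintype.card ι) (hl : 4 * l + 4 ≤ m)
    {R C : Finset (ι → V)} (hRC : ∀ x ∈ R, ∀ y ∈ C, #{i | g (x i) (y i) = true} ≠ m) :
    #R * (4 * D) ≤ Fintype.card (ι → V) ∨ #C * (4 * D) ≤ Fintype.card (ι → V) := by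
  by_contra! h
  have h1 := Nat.mul_le_mul h.1.le h.2.le
  rw [Fintype.card_fun] at h1
  have h2 : 4 * D * (4 * D) = 2 ^ (4 * l + 4) := by
    rw [show 4 * l + 4 = 2 * l + 2 * l + 4 by ring, pow_add, pow_add, hD]
    ring
  have h3 : Fintype.card V ^ (2 * Fintype.card ι) ≤ #R * #C * 2 ^ (4 * l + 4) := by
    rw [← h2, two_mul, pow_add]
    exact h1.trans_eq (by ring)
  have hd : (Fintype.card V : ℝ) ^ (2 * #(univ : Finset ι)) ≤ #R * #C * 2 ^ (4 * l + 4) := by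
    rw [Finset.card_univ]
    exact_mod_cast h3
  obtain ⟨x, hx, y, hy, hxy⟩ := exists_card_gadget_eq hg hK hKV
    (F := univ) (by rwa [Finset.card_univ])
    (fun x _ x' _ h => funext fun i => h i (Finset.mem_univ i))
    (fun x _ x' _ h => funext fun i => h i (Finset.mem_univ i)) hd hl
    (by rw [Finset.card_univ]; omega)
  exact hRC x hx y hy hxy

/-- On most rows and columns, rectangles covering every weight-`m` entry exactly once are
pairwise disjoint. -/
theorem exists_disjoint_subrectangle (hg : IsHadamard g) {K : ℝ} (hK : 0 < K)
    (hKV : (Fintype.card V : ℝ) = K ^ 2) (hι : 4 * (Fintype.card ι : ℝ) ≤ K) {κ : Type*}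
    [Fintype κ] {A B : κ → Set (ι → V)} {l m : ℕ} (hκ : Fintype.card κ ≤ 2 ^ l)
    (hm : 2 * m = Fintype.card ι) (hl : 4 * l + 4 ≤ m)
    (hAB : ∀ x y : ι → V, #{i | g (x i) (y i) = true} = m → ∀ k k',
      x ∈ A k ∧ y ∈ B k → x ∈ A k' ∧ y ∈ B k' → k = k') :
    ∃ X Y : Finset (ι → V), 3 * Fintype.card (ι → V) ≤ 4 * #X ∧
      3 * Fintype.card (ι → V) ≤ 4 * #Y ∧
      ∀ x ∈ X, ∀ y ∈ Y, ∀ k k', x ∈ A k ∧ y ∈ B k → x ∈ A k' ∧ y ∈ B k' → k = k' := by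
  obtain ⟨D, hD⟩ : ∃ D : ℕ, D = 2 ^ (2 * l) := ⟨_, rfl⟩
  obtain ⟨R, hR⟩ : ∃ R : κ × κ → Finset (ι → V), ∀ p x, x ∈ R p ↔ x ∈ A p.1 ∧ x ∈ A p.2 :=
    ⟨fun p => {x | x ∈ A p.1 ∧ x ∈ A p.2}, fun p x => by simp⟩
  obtain ⟨C, hC⟩ : ∃ C : κ × κ → Finset (ι → V), ∀ p y, y ∈ C p ↔ y ∈ B p.1 ∧ y ∈ B p.2 :=
    ⟨fun p => {y | y ∈ B p.1 ∧ y ∈ B p.2}, fun p y => by simp⟩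
  have hsmall : ∀ p : κ × κ, p.1 ≠ p.2 →
      #(R p) * (4 * D) ≤ Fintype.card (ι → V) ∨ #(C p) * (4 * D) ≤ Fintype.card (ι → V) := by
    refine fun p hp => card_mul_le_or_card_mul_le hg hK hKV hι hD hm hl fun x hx y hy hxy => ?_
    rw [hR] at hx
    rw [hC] at hy
    exact hp (hAB x y hxy _ _ ⟨hx.1, hy.1⟩ ⟨hx.2, hy.2⟩)
  have hD' : Fintype.card (κ × κ) ≤ D := by
    rw [Fintype.card_prod, hD, two_mul, pow_add]
    exact Nat.mul_le_mul hκ hκ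
  obtain ⟨X, hX, hXR⟩ := exists_forall_notMem_of_card_mul_le R hD'
  obtain ⟨Y, hY, hYC⟩ := exists_forall_notMem_of_card_mul_le C hD'
  refine ⟨X, Y, hX, hY, fun x hx y hy k k' hk hk' => ?_⟩
  by_contra hne
  rcases hsmall (k, k') hne with h | h
  · exact hXR _ h x hx ((hR _ _).2 ⟨hk.1, hk'.1⟩)
  · exact hYC _ h y hy ((hC _ _).2 ⟨hk.2, hk'.2⟩)

theorem isState_univ {X Y : Finset (ι → V)} (hX : 3 * Fintype.card (ι → V) ≤ 4 * #X)
    (hY : 3 * Fintype.card (ι → V) ≤ 4 * #Y) : IsState g univ X Y := by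
  have thick : ∀ {X : Finset (ι → V)}, 3 * Fintype.card (ι → V) ≤ 4 * #X →
      IsThick ((Fintype.card V : ℝ) / 4) univ X := by
    intro X hX j hj
    have h1 : Fintype.card V * projCard (univ.erase j) X ≤ Fintype.card (ι → V) := by
      refine (Nat.mul_le_mul_left _ (projCard_le_pow _ X)).trans_eq ?_
      rw [Fintype.card_fun, ← pow_succ', Finset.card_erase_add_one hj, Finset.card_univ]
    have h2 : (Fintype.card V : ℝ) * projCard (univ.erase j) X ≤ 4 * #X := by
      exact_mod_cast h1.trans (by omega)
    linarith
  exact ⟨fun x _ x' _ h => funext fun i => h i (Finset.mem_univ i),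
    fun x _ x' _ h => funext fun i => h i (Finset.mem_univ i),
    fun _ _ _ _ i hi => absurd (Finset.mem_univ i) hi, thick hX, thick hY⟩

/-- Few rectangles cannot cover the inputs of gadget weight `m` exactly once while avoiding the
inputs of gadget weight zero. -/
theorem IsHitting.not_exists_cover (h : IsHitting g U W τ η) (hτ : 0 ≤ τ)
    (hτN : 16 * τ * Fintype.card ι ≤ Fintype.card V) (hη₀ : 0 ≤ η) (hη : 2 * η ≤ 1)
    (hηι : 8 * η * Fintype.card ι ≤ 1) (hg : IsHadamard g) {K : ℝ} (hK : 0 < K)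
    (hKV : (Fintype.card V : ℝ) = K ^ 2) (hι : 4 * (Fintype.card ι : ℝ) ≤ K) {κ : Type*}
    [Fintype κ] {A B : κ → Set (ι → V)} {l m : ℕ} (hκ : Fintype.card κ + 1 ≤ 2 ^ l)
    (hm : 2 * m = Fintype.card ι) (hl : 4 * l + 4 ≤ m) (hl' : 2 * (4 * (l * (2 * l + 1)) + 1) ≤ m)
    (hone : ∀ x y : ι → V, #{i | g (x i) (y i) = true} = m → ∃! k, x ∈ A k ∧ y ∈ B k)
    (hzero : ∀ x y : ι → V, (∀ i, g (x i) (y i) = false) → ∀ k, ¬(x ∈ A k ∧ y ∈ B k)) :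
    False := by
  have hN : (0 : ℝ) < Fintype.card V := by rw [hKV]; positivity
  have hV : 0 < Fintype.card V := by exact_mod_cast hN
  obtain ⟨X, Y, hX, hY, hdisj⟩ := exists_disjoint_subrectangle hg hK hKV hι
    ((Nat.le_succ _).trans hκ) hm hl fun x y hxy k k' hk hk' => (hone x y hxy).unique hk hk'
  have hp : HasProtocol A B (l * (2 * l + 1)) X Y :=
    hasProtocol_of_disjoint hκ l (S := univ) hdisj (fun k hk => absurd (Finset.mem_univ k) hk)
      (by rwa [Finset.card_univ])
  have hs : IsState g univ X Y := isState_univ hX hY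
  have hcard : 0 < Fintype.card (ι → V) := by rw [Fintype.card_fun]; positivity
  have hXne : X.Nonempty := Finset.card_pos.1 (by omega)
  have hYne : Y.Nonempty := Finset.card_pos.1 (by omega)
  obtain ⟨F, X', Y', hX'ne, hY'ne, hs', hconst, hpot⟩ :=
    h.exists_isConstant hτ hτN hη₀ hη hηι hV hXne hYne hs hp
  have hpot₀ : 9 / 16 * 2 ^ Fintype.card ι ≤ potential (Fintype.card V) univ X Y := by
    rw [potential, hs.inj_left.projCard_eq, hs.inj_right.projCard_eq, Finset.card_univ]
    have a1 : 3 / 4 * (Fintype.card V : ℝ) ^ Fintype.card ι ≤ #X := by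
      rw [Fintype.card_fun] at hX
      have : (3 : ℝ) * (Fintype.card V : ℝ) ^ Fintype.card ι ≤ 4 * #X := by exact_mod_cast hX
      linarith
    have a2 : 3 / 4 * (Fintype.card V : ℝ) ^ Fintype.card ι ≤ #Y := by
      rw [Fintype.card_fun] at hY
      have : (3 : ℝ) * (Fintype.card V : ℝ) ^ Fintype.card ι ≤ 4 * #Y := by exact_mod_cast hY
      linarith
    set N : ℝ := (Fintype.card V : ℝ)
    calc 9 / 16 * (2 : ℝ) ^ Fintype.card ι
        = 9 / 16 * (N ^ 2 * (2 / N ^ 2)) ^ Fintype.card ι := by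
          rw [mul_div_cancel₀ _ (by positivity)]
      _ = (3 / 4 * N ^ Fintype.card ι) * (3 / 4 * N ^ Fintype.card ι) *
          (2 / N ^ 2) ^ Fintype.card ι := by rw [mul_pow]; ring
      _ ≤ _ := by gcongr
  obtain ⟨x, hx, y, hy, hxy⟩ :=
    hs'.exists_card_gadget_eq_of_potential hg hK hKV hι hm hl' (hpot₀.trans hpot)
  obtain ⟨x₀, hx₀, y₀, hy₀, hz⟩ :=
    h.exists_forall_gadget_eq_false hτ hτN hη₀ hη hηι hX'ne hY'ne hs'
  rcases hconst with ⟨k, hk⟩ | hk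
  · exact hzero x₀ y₀ hz k (hk x₀ hx₀ y₀ hy₀)
  · obtain ⟨k, hk', -⟩ := hone x y hxy
    exact hk k x hx y hy hk'

end Separation

section InnerProduct

theorem gadgetSign_IP {b : ℕ} (u v : Fin b → Bool) :
    gadgetSign (IP b) u v = ∏ j, if u j && v j then (-1 : ℝ) else 1 := by
  have h : ∀ j, (if u j && v j then (-1 : ℝ) else 1) = (-1) ^ ((u j).toNat * (v j).toNat) := by
    intro j
    cases u j <;> cases v j <;> simp
  simp only [h]
  rw [Finset.prod_pow_eq_pow_sum, gadgetSign, IP]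
  rcases Nat.even_or_odd (∑ j, (u j).toNat * (v j).toNat) with he | ho
  · rw [he.neg_one_pow, if_neg]
    simp [Nat.even_iff.1 he]
  · rw [ho.neg_one_pow, if_pos]
    simp [Nat.odd_iff.1 ho]

theorem isHadamard_IP (b : ℕ) : IsHadamard (IP b) := by
  intro v v'
  simp only [gadgetSign_IP, ← Finset.prod_mul_distrib]
  have h := Finset.prod_univ_sum (fun _ : Fin b => (univ : Finset Bool))
    (fun j c => (if c && v j then (-1 : ℝ) else 1) * if c && v' j then (-1 : ℝ) else 1)
  rw [Fintype.piFinset_univ] at h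
  refine h.symm.trans ?_
  split_ifs with hv
  · subst hv
    rw [Fintype.card_fun, Fintype.card_bool, Fintype.card_fin]
    push_cast
    rw [← Fin.prod_const b (2 : ℝ)]
    refine Finset.prod_congr rfl fun j _ => ?_
    cases v j <;> norm_num
  · obtain ⟨j, hj⟩ := Function.ne_iff.1 hv
    refine Finset.prod_eq_zero (Finset.mem_univ j) ?_
    cases h1 : v j <;> cases h2 : v' j <;> simp_all

/-- All fibers of a surjective homomorphism of finite groups have the same size. -/
theorem card_fiber_mul_card {G H : Type*} [AddGroup G] [AddGroup H] [Fintype G] [Fintype H]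
    (φ : G →+ H) (hφ : Function.Surjective φ) (w : H) :
    #{x | φ x = w} * Fintype.card H = Fintype.card G := by
  have h := Finset.card_eq_sum_card_fiberwise (s := (univ : Finset G)) (f := φ) (t := univ)
    fun x _ => Finset.mem_coe.2 (mem_univ _)
  rw [Finset.sum_congr rfl fun w' _ => AddMonoidHom.card_fiber_eq_of_mem_range φ (hφ w') (hφ w),
    Finset.sum_const, smul_eq_mul, Finset.card_univ, Finset.card_univ] at h
  rw [h, mul_comm]

theorem exists_linearMap_apply_eq {F E E' κ : Type*} [Field F] [AddCommGroup E] [Module F E]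
    [AddCommGroup E'] [Module F E'] [Fintype κ] {v : κ → E} (hv : LinearIndependent F v)
    (w : κ → E') : ∃ L : E →ₗ[F] E', ∀ i, L (v i) = w i := by
  obtain ⟨p, hp⟩ := (Fintype.linearCombination F v).exists_leftInverse_of_injective
    (LinearMap.ker_eq_bot.2 (linearIndependent_iff_injective_fintypeLinearCombination.1 hv))
  refine ⟨(Fintype.linearCombination F w).comp p, fun i => ?_⟩
  have h1 : v i = Fintype.linearCombination F v (Pi.single i 1) := by simp
  rw [LinearMap.comp_apply, h1, ← LinearMap.comp_apply p, hp]
  simp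

variable {k : ℕ}

/-- The number of matrices with prescribed values on linearly independent vectors. -/
theorem card_mulVec_eq_mul_pow {m : ℕ} {v : Fin m → Fin k → ZMod 2}
    (hv : LinearIndependent (ZMod 2) v) (w : Fin m → Fin k → ZMod 2) :
    #{T : Matrix (Fin k) (Fin k) (ZMod 2) | ∀ i, T.mulVec (v i) = w i} * (2 ^ k) ^ m =
      Fintype.card (Matrix (Fin k) (Fin k) (ZMod 2)) := by
  let φ : Matrix (Fin k) (Fin k) (ZMod 2) →+ (Fin m → Fin k → ZMod 2) :=
    { toFun := fun T i => T.mulVec (v i)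
      map_zero' := by ext; simp
      map_add' := fun T T' => funext fun i => Matrix.add_mulVec T T' (v i) }
  have hφ : Function.Surjective φ := by
    intro w
    obtain ⟨L, hL⟩ := exists_linearMap_apply_eq hv w
    exact ⟨LinearMap.toMatrix' L, funext fun i => by simp [φ, LinearMap.toMatrix'_mulVec, hL]⟩
  have h := card_fiber_mul_card φ hφ w
  rw [Fintype.card_fun, Fintype.card_fun, ZMod.card, Fintype.card_fin, Fintype.card_fin] at h
  rw [← h]
  congr 2
  ext T
  simp [φ, funext_iff]

theorem linearIndependent_pair_zmod_two {u u' : Fin k → ZMod 2} (hu : u ≠ 0) (hu' : u' ≠ 0)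
    (h : u ≠ u') : LinearIndependent (ZMod 2) ![u, u'] := by
  rw [LinearIndependent.pair_iff]
  have h2 : ∀ s : ZMod 2, s = 0 ∨ s = 1 := by decide
  intro s t hst
  rcases h2 s with rfl | rfl <;> rcases h2 t with rfl | rfl
  · exact ⟨rfl, rfl⟩
  · simp [hu'] at hst
  · simp [hu] at hst
  · refine absurd ?_ h
    rw [one_smul, one_smul] at hst
    rw [eq_neg_of_add_eq_zero_left hst]
    ext i
    exact ZModModule.neg_eq_self _

/-- A large set of point-value pairs is missed by few matrices. -/
theorem card_mulVec_miss_mul_le {Q : Finset ((Fin k → ZMod 2) × (Fin k → ZMod 2))}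
    (hQ : ∀ p ∈ Q, p.1 ≠ 0) :
    (#{T : Matrix (Fin k) (Fin k) (ZMod 2) | ∀ p ∈ Q, T.mulVec p.1 ≠ p.2} : ℝ) * #Q ≤
      Fintype.card (Matrix (Fin k) (Fin k) (ZMod 2)) * 2 ^ k := by
  set Ω := Matrix (Fin k) (Fin k) (ZMod 2) with hΩ
  set e : (Fin k → ZMod 2) × (Fin k → ZMod 2) → Ω → ℝ :=
    fun p T => if T.mulVec p.1 = p.2 then 1 else 0 with he
  set K : ℝ := 2 ^ k with hK
  have hK0 : 0 < K := by positivity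
  have e1 : ∀ p ∈ Q, (∑ T, e p T) * K = Fintype.card Ω := by
    intro p hp
    have h := card_mulVec_eq_mul_pow (v := ![p.1])
      (linearIndependent_unique_iff.2 (hQ p hp)) ![p.2]
    simp only [Fin.forall_fin_one, pow_one, Matrix.cons_val_zero] at h
    simp only [he]
    rw [Finset.sum_boole, hK]
    exact_mod_cast h
  have e2 : ∀ p ∈ Q, ∀ p' ∈ Q, p ≠ p' → (∑ T, e p T * e p' T) * K ^ 2 ≤ Fintype.card Ω := by
    intro p hp p' hp' hne
    have e3 : ∀ T, e p T * e p' T =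
        if T.mulVec p.1 = p.2 ∧ T.mulVec p'.1 = p'.2 then 1 else 0 := by
      intro T
      simp only [he]
      split_ifs <;> simp_all
    simp only [e3]
    rw [Finset.sum_boole]
    by_cases h1 : p.1 = p'.1
    · rw [Finset.filter_false_of_mem]
      · simp
      · rintro T - ⟨h2, h3⟩
        rw [h1, h3] at h2
        exact hne (Prod.ext h1 h2.symm)
    · have h := card_mulVec_eq_mul_pow
        (linearIndependent_pair_zmod_two (hQ p hp) (hQ p' hp') h1) ![p.2, p'.2]
      simp only [Fin.forall_fin_two, Matrix.cons_val_zero, Matrix.cons_val_one] at h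
      rw [hK]
      exact_mod_cast h.le
  set q : ℝ := (#Q : ℝ) with hq
  set M : Finset Ω := {T | ∀ p ∈ Q, T.mulVec p.1 ≠ p.2} with hM
  have m1 : (∑ T, ∑ p ∈ Q, e p T) * K = q * Fintype.card Ω := by
    rw [Finset.sum_comm, Finset.sum_mul, Finset.sum_congr rfl e1, Finset.sum_const, nsmul_eq_mul]
  have m2 : (∑ T, (∑ p ∈ Q, e p T) ^ 2) * K ^ 2 ≤ q * Fintype.card Ω * K + q ^ 2 * Fintype.card Ω := by
    have h1 : ∀ p ∈ Q, (∑ p' ∈ Q, ∑ T, e p T * e p' T) * K ^ 2 ≤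
        Fintype.card Ω * K + q * Fintype.card Ω := by
      intro p hp
      rw [← Finset.add_sum_erase _ _ hp, add_mul]
      refine add_le_add (le_of_eq ?_) ?_
      · have : ∀ T, e p T * e p T = e p T := by
          intro T
          simp only [he]
          split_ifs <;> simp
        simp only [this]
        rw [← e1 p hp]
        ring
      · rw [Finset.sum_mul]
        refine (Finset.sum_le_sum fun p' hp' => e2 p hp p' (Finset.mem_of_mem_erase hp')
          (Finset.ne_of_mem_erase hp').symm).trans ?_
        rw [Finset.sum_const, nsmul_eq_mul]
        gcongr
        exact Nat.cast_le.2 (Finset.card_le_card (Finset.erase_subset p Q))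
    have h2 : ∑ T, (∑ p ∈ Q, e p T) ^ 2 = ∑ p ∈ Q, ∑ p' ∈ Q, ∑ T, e p T * e p' T := by
      simp only [sq, Finset.sum_mul_sum]
      rw [Finset.sum_comm]
      exact Finset.sum_congr rfl fun p _ => Finset.sum_comm
    rw [h2, Finset.sum_mul]
    refine (Finset.sum_le_sum h1).trans_eq ?_
    rw [Finset.sum_const, nsmul_eq_mul]
    ring
  have m3 : (#M : ℝ) * q ^ 2 ≤ ∑ T, ((∑ p ∈ Q, e p T) * K - q) ^ 2 := by
    rw [← nsmul_eq_mul, ← Finset.sum_const]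
    refine (Finset.sum_le_sum fun T hT => ?_).trans
      (Finset.sum_le_sum_of_subset_of_nonneg (Finset.subset_univ M) fun T _ _ => sq_nonneg _)
    have : ∑ p ∈ Q, e p T = 0 :=
      Finset.sum_eq_zero fun p hp => if_neg ((Finset.mem_filter.1 hT).2 p hp)
    rw [this]
    simp
  have m4 : ∑ T, ((∑ p ∈ Q, e p T) * K - q) ^ 2 =
      (∑ T, (∑ p ∈ Q, e p T) ^ 2) * K ^ 2 - 2 * q * ((∑ T, ∑ p ∈ Q, e p T) * K) +
        Fintype.card Ω * q ^ 2 := by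
    have h : ∀ T, ((∑ p ∈ Q, e p T) * K - q) ^ 2 =
        (∑ p ∈ Q, e p T) ^ 2 * K ^ 2 - (∑ p ∈ Q, e p T) * (2 * q * K) + q ^ 2 := by
      intro T
      ring
    simp only [h, Finset.sum_add_distrib, Finset.sum_sub_distrib, Finset.sum_const,
      Finset.card_univ, nsmul_eq_mul, ← Finset.sum_mul]
    ring
  rw [m1] at m4
  have m5 : (#M : ℝ) * q ^ 2 ≤ q * (Fintype.card Ω * K) := by linarith
  rcases (show 0 ≤ q from Nat.cast_nonneg _).eq_or_lt with h0 | h0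
  · rw [← h0, mul_zero]
    positivity
  · refine le_of_mul_le_mul_left ?_ h0
    linarith

/-- The first half of a bit string, as a vector over the field with two elements. -/
def loHalf (x : Fin (k + k) → Bool) : Fin k → ZMod 2 :=
  fun i => ((x (Fin.castAdd k i)).toNat : ZMod 2)

/-- The second half of a bit string, as a vector over the field with two elements. -/
def hiHalf (x : Fin (k + k) → Bool) : Fin k → ZMod 2 :=
  fun i => ((x (Fin.natAdd k i)).toNat : ZMod 2)

theorem IP_eq_false_iff (x y : Fin (k + k) → Bool) :
    IP (k + k) x y = false ↔ loHalf x ⬝ᵥ loHalf y + hiHalf x ⬝ᵥ hiHalf y = 0 := by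
  rw [IP, decide_eq_false_iff_not, ← ne_eq, Nat.mod_two_ne_one, ← Nat.dvd_iff_mod_eq_zero,
    ← ZMod.natCast_eq_zero_iff, Fin.sum_univ_add]
  push_cast
  rfl

theorem halves_injective {x y : Fin (k + k) → Bool} (h₁ : loHalf x = loHalf y)
    (h₂ : hiHalf x = hiHalf y) : x = y := by
  have h : ∀ c d : Bool, (c.toNat : ZMod 2) = d.toNat → c = d := by decide
  ext i : 1
  refine Fin.addCases (fun i => ?_) (fun i => ?_) i
  · exact h _ _ (congrFun h₁ i)
  · exact h _ _ (congrFun h₂ i)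

theorem IP_eq_false_of_mulVec (T : Matrix (Fin k) (Fin k) (ZMod 2)) {x y : Fin (k + k) → Bool}
    (hx : T.mulVec (loHalf x) = hiHalf x) (hy : T.transpose.mulVec (hiHalf y) = loHalf y) :
    IP (k + k) x y = false := by
  rw [IP_eq_false_iff, ← hx, ← hy, Matrix.mulVec_transpose, dotProduct_comm (loHalf x),
    ← Matrix.dotProduct_mulVec, dotProduct_comm (hiHalf y)]
  exact CharTwo.add_self_eq_zero _

theorem card_mulVec_miss_le {n : ℕ} (hn : 0 < n) (hk : 256 * n ^ 2 ≤ 2 ^ k) {β : Type*}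
    {f h : β → Fin k → ZMod 2} (hfh : ∀ x y, f x = f y → h x = h y → x = y) (S : Finset β)
    (hS : (2 : ℝ) ^ (k + k) / (16 * n) ≤ #S) {M : Finset (Matrix (Fin k) (Fin k) (ZMod 2))}
    (hM : ∀ T ∈ M, ∀ x ∈ S, T.mulVec (f x) ≠ h x) :
    (#M : ℝ) ≤ 1 / (8 * n) * Fintype.card (Matrix (Fin k) (Fin k) (ZMod 2)) := by
  have hn' : (1 : ℝ) ≤ n := by exact_mod_cast hn
  have hk' : 256 * (n : ℝ) ^ 2 ≤ 2 ^ k := by exact_mod_cast hk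
  set K : ℝ := 2 ^ k with hK
  have hK0 : 0 < K := by positivity
  set S' : Finset β := {x ∈ S | f x ≠ 0} with hS'
  set Q := S'.image fun x => (f x, h x) with hQ
  have hQc : #Q = #S' := Finset.card_image_of_injective _ fun x y hxy =>
    hfh x y (Prod.ext_iff.1 hxy).1 (Prod.ext_iff.1 hxy).2
  have h0 : #{x ∈ S | ¬ f x ≠ 0} ≤ 2 ^ k := by
    have : Fintype.card (Fin k → ZMod 2) = 2 ^ k := by
      rw [Fintype.card_fun, ZMod.card, Fintype.card_fin]
    rw [← this, ← Finset.card_univ]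
    refine Finset.card_le_card_of_injOn h (fun _ _ => Finset.mem_coe.2 (Finset.mem_univ _)) ?_
    intro x hx y hy hxy
    have hx' := (Finset.mem_filter.1 hx).2
    have hy' := (Finset.mem_filter.1 hy).2
    rw [not_not] at hx' hy'
    exact hfh x y (hx'.trans hy'.symm) hxy
  have h1 : (#S : ℝ) ≤ #S' + K := by
    rw [hK, ← Finset.card_filter_add_card_filter_not (s := S) fun x => f x ≠ 0]
    push_cast
    have : (#{x ∈ S | ¬ f x ≠ 0} : ℝ) ≤ 2 ^ k := by exact_mod_cast h0
    linarith
  have h2 : K * (8 * n) ≤ #S' := by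
    have h3 : K * (16 * n) ≤ K ^ 2 / (16 * n) := by
      rw [le_div_iff₀ (by positivity), sq]
      have : K * (256 * (n : ℝ) ^ 2) ≤ K * K := by gcongr
      linarith
    rw [pow_add, ← hK, ← sq] at hS
    nlinarith
  have h3 := card_mulVec_miss_mul_le (Q := Q) fun p hp => by
    obtain ⟨x, hx, rfl⟩ := Finset.mem_image.1 hp
    exact (Finset.mem_filter.1 hx).2
  rw [hQc, ← hK] at h3
  have h4 : (#M : ℝ) ≤
      #{T : Matrix (Fin k) (Fin k) (ZMod 2) | ∀ p ∈ Q, T.mulVec p.1 ≠ p.2} := by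
    refine Nat.cast_le.2 (Finset.card_le_card fun T hT => ?_)
    refine Finset.mem_filter.2 ⟨Finset.mem_univ T, fun p hp => ?_⟩
    obtain ⟨x, hx, rfl⟩ := Finset.mem_image.1 hp
    exact hM T hT x (Finset.mem_filter.1 hx).1
  have h5 : (#M : ℝ) * (K * (8 * n)) ≤ Fintype.card (Matrix (Fin k) (Fin k) (ZMod 2)) * K :=
    le_trans (by gcongr) h3
  rw [one_div, inv_mul_eq_div, le_div_iff₀ (by positivity)]
  refine le_of_mul_le_mul_right ?_ hK0
  linarith

theorem isHitting_of_forall {Ω : Type*} [Fintype Ω] {g : V → V → Bool} {U W : Ω → Set V} {τ η : ℝ}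
    (hg : ∀ ω, ∀ u ∈ U ω, ∀ w ∈ W ω, g u w = false)
    (hU : ∀ S : Finset V, τ ≤ #S → ∀ M : Finset Ω, (∀ ω ∈ M, ∀ v ∈ S, v ∉ U ω) →
      (#M : ℝ) ≤ η * Fintype.card Ω)
    (hW : ∀ S : Finset V, τ ≤ #S → ∀ M : Finset Ω, (∀ ω ∈ M, ∀ v ∈ S, v ∉ W ω) →
      (#M : ℝ) ≤ η * Fintype.card Ω) : IsHitting g U W τ η :=
  ⟨hg, fun S hS => hU S hS _ fun _ h => (Finset.mem_filter.1 h).2,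
    fun S hS => hW S hS _ fun _ h => (Finset.mem_filter.1 h).2⟩

theorem isHitting_IP {n : ℕ} (hn : 0 < n) (hk : 256 * n ^ 2 ≤ 2 ^ k) :
    IsHitting (IP (k + k))
      (fun T : Matrix (Fin k) (Fin k) (ZMod 2) => {x | T.mulVec (loHalf x) = hiHalf x})
      (fun T => {y | T.transpose.mulVec (hiHalf y) = loHalf y})
      ((2 : ℝ) ^ (k + k) / (16 * n)) (1 / (8 * n)) := by
  refine isHitting_of_forall (fun T x hx y hy => IP_eq_false_of_mulVec T hx hy)
    (fun S hS M hM => card_mulVec_miss_le hn hk (fun x y h₁ h₂ => halves_injective h₁ h₂) S hS hM)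
    fun S hS M hM => ?_
  rw [← Finset.card_image_of_injective _ Matrix.transpose_injective]
  refine card_mulVec_miss_le hn hk (fun x y h₁ h₂ => halves_injective h₂ h₁) S hS fun T hT => ?_
  obtain ⟨T', hT', rfl⟩ := Finset.mem_image.1 hT
  exact hM T' hT'

end InnerProduct

end Lifting

section Ranks

theorem hw_gpow {b n : ℕ} (g : (Fin b → Bool) → (Fin b → Bool) → Bool) (x y : Fin n → Fin b → Bool) :
    hw (gpow g x y) = (Finset.univ.filter fun i => g (x i) (y i) = true).card := rfl

theorem composed_eq_some_true_iff {b n : ℕ} {g : (Fin b → Bool) → (Fin b → Bool) → Bool}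
    {x y : Fin n → Fin b → Bool} :
    composed b n g x y = some true ↔ hw (gpow g x y) = n / 2 := by
  rw [composed, fPartial]
  split_ifs <;> simp_all

theorem composed_eq_some_false_iff {b n : ℕ} (hn : n / 2 ≠ 0)
    {g : (Fin b → Bool) → (Fin b → Bool) → Bool} {x y : Fin n → Fin b → Bool} :
    composed b n g x y = some false ↔ hw (gpow g x y) = 0 := by
  rw [composed, fPartial]
  split_ifs with h₁ h₂
  · simp [h₁, hn]
  · simp [h₂]
  · simp [h₂]

theorem pnnRank_composed_le {b n : ℕ} (hn : n / 2 ≠ 0) (he : Even n)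
    (g : (Fin b → Bool) → (Fin b → Bool) → Bool) : pnnRank (composed b n g) ≤ n * 2 ^ b := by
  refine Nat.sInf_le ?_
  have σ : Fin (n * 2 ^ b) ≃ Fin n × (Fin b → Bool) := Fintype.equivOfCardEq (by simp)
  refine ⟨fun k x => if x (σ k).1 = (σ k).2 then 2 / n else 0,
    fun k y => if g (σ k).2 (y (σ k).1) = true then 1 else 0, fun k x => by positivity,
    fun k y => by positivity, fun x y => ?_⟩
  have key : ∑ k, (if x (σ k).1 = (σ k).2 then (2 / n : ℝ) else 0) *
      (if g (σ k).2 (y (σ k).1) = true then 1 else 0) = 2 / n * hw (gpow g x y) := by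
    rw [σ.sum_comp fun p => (if x p.1 = p.2 then (2 / n : ℝ) else 0) *
      (if g p.2 (y p.1) = true then 1 else 0), Fintype.sum_prod_type, hw_gpow,
      ← Finset.sum_boole, Finset.mul_sum]
    refine Finset.sum_congr rfl fun i _ => ?_
    rw [Fintype.sum_eq_single (x i) fun α hα => by rw [if_neg hα.symm, zero_mul], if_pos rfl]
  have h2 : ((n / 2 : ℕ) : ℝ) = n / 2 := Nat.cast_div_charZero he.two_dvd
  have hn' : (n : ℝ) ≠ 0 := by
    rintro h
    rw [Nat.cast_eq_zero] at h
    simp [h] at hn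
  rw [key, composed_eq_some_true_iff, composed_eq_some_false_iff hn]
  refine ⟨fun h => ?_, fun h => ?_⟩
  · rw [h, h2]
    field_simp
  · rw [h, Nat.cast_zero, mul_zero]

theorem exists_pbinCover {α β : Type*} [Finite α] [Finite β] (M : α → β → Option Bool) :
    ∃ r, PBinCover M r := by
  obtain ⟨r, ⟨σ⟩⟩ := Finite.exists_equiv_fin {p : α × β // M p.1 p.2 = some true}
  refine ⟨r, fun k => {(σ.symm k).1.1}, fun k => {(σ.symm k).1.2}, fun i j h => ?_,
    fun i j h k hk => ?_⟩
  · refine ⟨σ ⟨(i, j), h⟩, by simp, fun k hk => ?_⟩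
    rw [← Equiv.symm_apply_eq]
    exact Subtype.ext (Prod.ext hk.1.symm hk.2.symm)
  · have := (σ.symm k).2
    rw [← Set.mem_singleton_iff.1 hk.1, ← Set.mem_singleton_iff.1 hk.2, h] at this
    simp at this

theorem pbinCover_pbinRank {α β : Type*} [Finite α] [Finite β] (M : α → β → Option Bool) :
    PBinCover M (pbinRank M) :=
  Nat.sInf_mem (exists_pbinCover M)

theorem two_pow_le_pbinRank {k l m n : ℕ} (hk : 256 * n ^ 2 ≤ 2 ^ k) (hm : 2 * m = n)
    (hl : 4 * l + 4 ≤ m) (hl' : 2 * (4 * (l * (2 * l + 1)) + 1) ≤ m) :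
    2 ^ l ≤ pbinRank (composed (k + k) n (IP (k + k))) := by
  by_contra! hlt
  obtain ⟨A, B, hone, hzero⟩ := pbinCover_pbinRank (composed (k + k) n (IP (k + k)))
  have hn : 0 < n := by omega
  have hn1 : (1 : ℝ) ≤ n := by exact_mod_cast hn
  have hk' : 256 * (n : ℝ) ^ 2 ≤ 2 ^ k := by exact_mod_cast hk
  refine (isHitting_IP hn hk).not_exists_cover (ι := Fin n) (K := 2 ^ k) (A := A) (B := B)
    (l := l) (m := m) (by positivity) ?_ (by positivity) ?_ ?_ (isHadamard_IP _) (by positivity)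
    ?_ ?_ ?_ ?_ hl hl' (fun x y h => hone x y ?_) fun x y h => hzero x y ?_
  · rw [Fintype.card_fun, Fintype.card_bool, Fintype.card_fin, Fintype.card_fin]
    push_cast
    field_simp
    norm_num
  · rw [mul_one_div, div_le_one (by positivity)]
    linarith
  · rw [Fintype.card_fin]
    field_simp
    norm_num
  · rw [Fintype.card_fun, Fintype.card_bool, Fintype.card_fin, ← pow_mul, mul_two]
    push_cast
    rfl
  · rw [Fintype.card_fin]
    nlinarith
  · rw [Fintype.card_fin]
    exact hlt
  · rw [Fintype.card_fin, hm]
  · rw [composed_eq_some_true_iff, hw_gpow, h]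
    omega
  · rw [composed_eq_some_false_iff (by omega), hw_gpow, Finset.card_eq_zero,
      Finset.filter_eq_empty_iff]
    intro i _
    simp [h i]

theorem bOf_two_pow (a : ℕ) : bOf (2 ^ a) = 100 * a := by
  rw [bOf]
  push_cast
  rw [Real.logb_pow, Real.logb_self_eq_one (by norm_num), mul_one]
  exact_mod_cast Nat.ceil_natCast (R := ℝ) (100 * a)

end Ranks

/-- There is a constant `ε > 0` such that for every `n₀` there is an
even `n ≥ n₀` for which the partial matrix `M = f ∘ gⁿ` (with `f` the partial function
that is 1 on weight-`n/2` inputs and 0 on the all-zeros input, and `g` the confounding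
gadget on `⌈100 log₂ n⌉` bits) satisfies `rank₀₁(M) ≥ 2 ^ (rank₊(M) ^ ε)`. -/
theorem partial_exponential_separation :
    ∃ ε : ℝ, 0 < ε ∧ ∀ n₀ : ℕ, ∃ n : ℕ, n₀ ≤ n ∧ Even n ∧
      (2 : ℝ) ^ ((pnnRank (composed (bOf n) n (IP (bOf n))) : ℝ) ^ ε) ≤
        (pbinRank (composed (bOf n) n (IP (bOf n))) : ℝ) := by
  refine ⟨1 / 808, by norm_num, fun n₀ => ?_⟩
  set e : ℕ := n₀ + 1
  have he : n₀ + 1 = e := rfl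
  clear_value e
  obtain ⟨a, ha⟩ : ∃ a, a = 2 * e + 6 := ⟨_, rfl⟩
  have hb : bOf (2 ^ a) = 50 * a + 50 * a := by rw [bOf_two_pow]; ring
  have hn : 2 * (32 * 2 ^ e * 2 ^ e) = 2 ^ a := by
    rw [ha, pow_add, two_mul e, pow_add]
    ring
  have hl : 2 ≤ 2 ^ e := by
    rw [← he, pow_succ]
    have := Nat.one_le_two_pow (n := n₀)
    omega
  refine ⟨2 ^ a, ?_, ?_, ?_⟩
  · exact (by omega : n₀ ≤ a).trans Nat.lt_two_pow_self.le
  · rw [← hn]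
    exact even_two_mul _
  rw [hb]
  have hbin := two_pow_le_pbinRank (k := 50 * a) (l := 2 ^ e) (m := 32 * 2 ^ e * 2 ^ e)
    (n := 2 ^ a) ?_ hn (by nlinarith) (by nlinarith)
  · have hpnn := pnnRank_composed_le (b := 50 * a + 50 * a) (n := 2 ^ a)
      (by rw [← hn, Nat.mul_div_cancel_left _ two_pos]; positivity)
      (by rw [← hn]; exact even_two_mul _) (IP (50 * a + 50 * a))
    rw [← pow_add] at hpnn
    have h1 : (pnnRank (composed (50 * a + 50 * a) (2 ^ a) (IP (50 * a + 50 * a))) : ℝ) ^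
        (1 / 808 : ℝ) ≤ ((2 ^ e : ℕ) : ℝ) := by
      calc _ ≤ ((2 : ℝ) ^ (a + (50 * a + 50 * a))) ^ (1 / 808 : ℝ) :=
            Real.rpow_le_rpow (Nat.cast_nonneg _) (by exact_mod_cast hpnn) (by norm_num)
        _ ≤ ((2 : ℝ) ^ (808 * e)) ^ (1 / 808 : ℝ) :=
            Real.rpow_le_rpow (by positivity)
              (pow_le_pow_right₀ (by norm_num) (by omega)) (by norm_num)
        _ = _ := by
            rw [mul_comm, pow_mul, one_div]
            push_cast
            exact Real.pow_rpow_inv_natCast (n := 808) (by positivity) (by norm_num)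
    calc _ ≤ (2 : ℝ) ^ ((2 ^ e : ℕ) : ℝ) := Real.rpow_le_rpow_of_exponent_le (by norm_num) h1
      _ = ((2 ^ 2 ^ e : ℕ) : ℝ) := by rw [Real.rpow_natCast]; push_cast; rfl
      _ ≤ _ := by exact_mod_cast hbin
  · calc 256 * (2 ^ a) ^ 2 = 2 ^ (8 + 2 * a) := by rw [pow_add, ← pow_mul, mul_comm a]; norm_num
      _ ≤ _ := Nat.pow_le_pow_right (by norm_num) (by omega)
end

section
/- For every total 0-1 matrix M, if rank₊(M) ≤ 3 then rank₊(M) = rank₀₁(M). -/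
/-- `M` is a total 0-1 matrix: every entry is `0` or `1`. -/
def Is01 {α β : Type*} (M : Matrix α β ℝ) : Prop :=
  ∀ i j, M i j = 0 ∨ M i j = 1

/-- `M` is a sum of `r` entrywise-nonnegative rank-at-most-1 real matrices,
the `k`-th summand being the outer product of the nonnegative vectors `u k` and `v k`. -/
def NNDecomp {α β : Type*} (M : Matrix α β ℝ) (r : ℕ) : Prop :=
  ∃ (u : Fin r → α → ℝ) (v : Fin r → β → ℝ),
    (∀ k i, 0 ≤ u k i) ∧ (∀ k j, 0 ≤ v k j) ∧
    ∀ i j, M i j = ∑ k, u k i * v k j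

/-- The nonnegative rank `rank₊(M)`: the smallest `r` such that `M` is a sum of `r`
entrywise-nonnegative rank-at-most-1 real matrices. -/
noncomputable def nnRank {α β : Type*} (M : Matrix α β ℝ) : ℕ :=
  sInf {r | NNDecomp M r}

/-- `M` is a sum of `r` rank-at-most-1 matrices all of whose entries are in `{0,1}`,
the `k`-th summand being the outer product of the 0-1 vectors `u k` and `v k`. -/
def BinDecomp {α β : Type*} (M : Matrix α β ℝ) (r : ℕ) : Prop :=
  ∃ (u : Fin r → α → ℝ) (v : Fin r → β → ℝ),
    (∀ k i, u k i = 0 ∨ u k i = 1) ∧ (∀ k j, v k j = 0 ∨ v k j = 1) ∧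
    ∀ i j, M i j = ∑ k, u k i * v k j

/-- The binary rank `rank₀₁(M)`: the smallest `r` such that `M` is a sum of `r`
rank-at-most-1 matrices with entries in `{0,1}`. -/
noncomputable def binRank {α β : Type*} (M : Matrix α β ℝ) : ℕ :=
  sInf {r | BinDecomp M r}

/-- `M` is a real combination of `r` columns with entries in `{0,1}`, namely the indicators
of the sets `s k`. -/
def IndicatorDecomp {α β : Type*} [DecidableEq α] (M : Matrix α β ℝ) {r : ℕ}
    (s : Fin r → Finset α) (w : Fin r → β → ℝ) : Prop :=
  ∀ i j, M i j = ∑ k, if i ∈ s k then w k j else 0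

theorem BinDecomp.nnDecomp {α β : Type*} {M : Matrix α β ℝ} {r : ℕ} (h : BinDecomp M r) :
    NNDecomp M r := by
  obtain ⟨u, v, hu, hv, hM⟩ := h
  refine ⟨u, v, fun k i => ?_, fun k j => ?_, hM⟩
  · rcases hu k i with h | h <;> rw [h]; norm_num
  · rcases hv k j with h | h <;> rw [h]; norm_num

theorem Is01.binDecomp_card {α β : Type*} [Fintype β] {M : Matrix α β ℝ} (hM : Is01 M) :
    BinDecomp M (Fintype.card β) := by
  classical
  let e := Fintype.equivFin β
  refine ⟨fun k i => M i (e.symm k), fun k j => if e j = k then 1 else 0,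
    fun k i => hM _ _, fun k j => ?_, fun i j => by simp⟩
  by_cases h : e j = k <;> simp [h]

/-- The fooling set bound: a fooling set of size `n` forces nonnegative rank at least `n`. -/
theorem NNDecomp.card_fooling_le {α β : Type*} {M : Matrix α β ℝ} {r n : ℕ}
    (h : NNDecomp M r) (a : Fin n → α) (b : Fin n → β) (hdiag : ∀ s, M (a s) (b s) ≠ 0)
    (hoff : ∀ s t, s ≠ t → M (a s) (b t) = 0 ∨ M (a t) (b s) = 0) : n ≤ r := by
  obtain ⟨u, v, hu, hv, hM⟩ := h
  have key : ∀ s, ∃ k, u k (a s) * v k (b s) ≠ 0 := fun s => by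
    by_contra! hs
    exact hdiag s (by rw [hM]; exact Finset.sum_eq_zero fun k _ => hs k)
  have hzero : ∀ i j k, M i j = 0 → u k i * v k j = 0 := fun i j k hij => by
    rw [hM] at hij
    exact (Finset.sum_eq_zero_iff_of_nonneg fun k _ => mul_nonneg (hu k i) (hv k j)).1 hij k
      (Finset.mem_univ k)
  choose f hf using key
  have hinj : Function.Injective f := fun s t hst => by
    by_contra hne
    have hs := hf s
    have ht := hf t
    rw [← hst] at ht
    rw [mul_ne_zero_iff] at hs ht
    rcases hoff s t hne with h0 | h0
    · exact mul_ne_zero hs.1 ht.2 (hzero _ _ _ h0)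
    · exact mul_ne_zero ht.1 hs.2 (hzero _ _ _ h0)
  simpa using Fintype.card_le_of_injective f hinj

/-- A decomposition into indicators can be chosen with no nonempty set contained in another. -/
theorem IndicatorDecomp.exists_antichain {α β : Type*} [DecidableEq α] {M : Matrix α β ℝ}
    {r : ℕ} (s : Fin r → Finset α) (w : Fin r → β → ℝ) (h : IndicatorDecomp M s w) :
    ∃ (s' : Fin r → Finset α) (w' : Fin r → β → ℝ), IndicatorDecomp M s' w' ∧
      ∀ k l, k ≠ l → (s' k).Nonempty → ¬ s' k ⊆ s' l := by
  induction hn : ∑ k, (s k).card using Nat.strong_induction_on generalizing s w with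
  | _ n ih =>
  by_cases hred : ∀ k l, k ≠ l → (s k).Nonempty → ¬ s k ⊆ s l
  · exact ⟨s, w, h, hred⟩
  push Not at hred
  obtain ⟨k, l, hkl, hne, hsub⟩ := hred
  refine ih _ ?_ (Function.update s l (s l \ s k)) (Function.update w k (w k + w l)) ?_ rfl
  · rw [← hn]
    refine Finset.sum_lt_sum (fun m _ => ?_) ⟨l, Finset.mem_univ l, ?_⟩
    · rcases eq_or_ne m l with rfl | hm
      · simpa using Finset.card_le_card Finset.sdiff_subset
      · simp [hm]
    · simpa using Finset.card_lt_card (Finset.sdiff_ssubset hsub hne)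
  · intro i j
    rw [h i j]
    have hterm : ∀ m, (if i ∈ Function.update s l (s l \ s k) m
          then Function.update w k (w k + w l) m j else 0) =
        (if i ∈ s m then w m j else 0) + (if m = k then (if i ∈ s k then w l j else 0) else 0)
          - (if m = l then (if i ∈ s k then w l j else 0) else 0) := fun m => by
      rcases eq_or_ne m l with rfl | hml
      · by_cases hik : i ∈ s k
        · simp [hik, hsub hik, hkl.symm]
        · simp [hik, hkl.symm]
      · rcases eq_or_ne m k with rfl | hmk
        · by_cases hik : i ∈ s m <;> simp [hik, hml]
        · simp [hml, hmk]
    simp only [hterm, Finset.sum_sub_distrib, Finset.sum_add_distrib]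
    simp

/-- If every nonempty set has a point in no other set, the decomposition is binary. -/
theorem IndicatorDecomp.binDecomp_of_private {α β : Type*} [DecidableEq α] {M : Matrix α β ℝ}
    (hM : Is01 M) {r : ℕ} {s : Fin r → Finset α} {w : Fin r → β → ℝ}
    (h : IndicatorDecomp M s w)
    (hp : ∀ k, (s k).Nonempty → ∃ i ∈ s k, ∀ l, l ≠ k → i ∉ s l) : BinDecomp M r := by
  classical
  refine ⟨fun k i => if i ∈ s k then 1 else 0, fun k j => if (s k).Nonempty then w k j else 0,
    fun k i => ?_, fun k j => ?_, fun i j => ?_⟩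
  · by_cases hi : i ∈ s k <;> simp [hi]
  · by_cases hk : (s k).Nonempty
    · obtain ⟨i, hi, hl⟩ := hp k hk
      have hij := hM i j
      rw [h i j, Finset.sum_eq_single k (fun l _ hlk => if_neg (hl l hlk)) (by simp),
        if_pos hi] at hij
      simpa only [if_pos hk] using hij
    · simp [hk]
  · rw [h i j]
    refine Finset.sum_congr rfl fun k _ => ?_
    by_cases hi : i ∈ s k
    · have hk : (s k).Nonempty := ⟨i, hi⟩
      simp [hi, hk]
    · simp [hi]

theorem binDecomp_three {α β : Type*} {M : Matrix α β ℝ} (x y z : α → ℝ) (p q r : β → ℝ)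
    (hx : ∀ i, x i = 0 ∨ x i = 1) (hy : ∀ i, y i = 0 ∨ y i = 1) (hz : ∀ i, z i = 0 ∨ z i = 1)
    (hp : ∀ j, p j = 0 ∨ p j = 1) (hq : ∀ j, q j = 0 ∨ q j = 1) (hr : ∀ j, r j = 0 ∨ r j = 1)
    (h : ∀ i j, M i j = x i * p j + y i * q j + z i * r j) : BinDecomp M 3 := by
  refine ⟨![x, y, z], ![p, q, r], fun k => ?_, fun k => ?_, fun i j => ?_⟩
  · fin_cases k <;> assumption
  · fin_cases k <;> assumption
  · rw [h, Fin.sum_univ_three]; rfl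

/-- The case in which the first two columns have private rows and the third has none: either the
matrix has binary rank at most three or it contains an 8-cycle, which has a fooling set of size
four. -/
theorem binDecomp_three_of_two_private {α β : Type*} {M : Matrix α β ℝ} (hM : Is01 M)
    (hN : NNDecomp M 3) (x y z : α → ℝ) (p q r : β → ℝ)
    (hx : ∀ i, x i = 0 ∨ x i = 1) (hy : ∀ i, y i = 0 ∨ y i = 1) (hz : ∀ i, z i = 0 ∨ z i = 1)
    (h : ∀ i j, M i j = x i * p j + y i * q j + z i * r j)
    {a b c d : α} (ha : x a = 1 ∧ y a = 0 ∧ z a = 0) (hb : x b = 0 ∧ y b = 1 ∧ z b = 0)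
    (hc : x c = 0 ∧ y c = 1 ∧ z c = 1) (hd : x d = 1 ∧ y d = 0 ∧ z d = 1) :
    BinDecomp M 3 := by
  classical
  obtain ⟨ax, ay, az⟩ := ha
  obtain ⟨bx, bY, bz⟩ := hb
  obtain ⟨cx, cy, cz⟩ := hc
  obtain ⟨dx, dy, dz⟩ := hd
  have Ma : ∀ j, M a j = p j := fun j => by rw [h, ax, ay, az]; ring
  have Mb : ∀ j, M b j = q j := fun j => by rw [h, bx, bY, bz]; ring
  have Mc : ∀ j, M c j = q j + r j := fun j => by rw [h, cx, cy, cz]; ring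
  have Md : ∀ j, M d j = p j + r j := fun j => by rw [h, dx, dy, dz]; ring
  have class_col : ∀ j, (p j = 0 ∧ q j = 0 ∧ r j = 0) ∨ (p j = 1 ∧ q j = 0 ∧ r j = 0) ∨
      (p j = 0 ∧ q j = 1 ∧ r j = 0) ∨ (p j = 0 ∧ q j = 0 ∧ r j = 1) ∨
      (p j = 1 ∧ q j = 1 ∧ r j = 0) ∨ (p j = 1 ∧ q j = 1 ∧ r j = -1) := fun j => by
    have h1 := hM a j
    have h2 := hM b j
    have h3 := hM c j
    have h4 := hM d j
    rw [Ma] at h1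
    rw [Mb] at h2
    rw [Mc] at h3
    rw [Md] at h4
    grind
  by_cases hneg : ∃ j, p j = 1 ∧ q j = 1 ∧ r j = -1
  swap
  · exact binDecomp_three x y z p q r hx hy hz (by grind) (by grind) (by grind) h
  obtain ⟨n, hn⟩ := hneg
  have hf : ∀ i, M i n = x i + y i - z i := fun i => by
    rw [h, hn.1, hn.2.1, hn.2.2]; ring
  by_cases h1 : ∃ j, p j = 1 ∧ q j = 0 ∧ r j = 0
  swap
  · refine binDecomp_three y z (fun i => M i n) (fun j => if p j = 0 then q j else 0)
      (fun j => if p j = 0 then r j else 1 + r j) p hy hz (fun i => hM i n)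
      (by grind) (by grind) (by grind) fun i j => ?_
    rw [h, hf]
    rcases class_col j with hj | hj | hj | hj | hj | hj
    · simp [hj]
    · exact absurd ⟨j, hj⟩ h1
    all_goals simp [hj]
    ring
  by_cases h2 : ∃ j, p j = 0 ∧ q j = 1 ∧ r j = 0
  swap
  · refine binDecomp_three x z (fun i => M i n) (fun j => if q j = 0 then p j else 0)
      (fun j => if q j = 0 then r j else 1 + r j) q hx hz (fun i => hM i n)
      (by grind) (by grind) (by grind) fun i j => ?_
    rw [h, hf]
    rcases class_col j with hj | hj | hj | hj | hj | hj
    · simp [hj]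
    · simp [hj]
    · exact absurd ⟨j, hj⟩ h2
    all_goals simp [hj]
    ring
  by_cases h3 : ∃ j, p j = 0 ∧ q j = 0 ∧ r j = 1
  swap
  · refine binDecomp_three x y (fun i => M i n) (fun j => p j + r j)
      (fun j => q j + r j) (fun j => -r j) hx hy (fun i => hM i n)
      (by grind) (by grind) (by grind) fun i j => ?_
    rw [h, hf]
    ring
  obtain ⟨j1, hj1⟩ := h1
  obtain ⟨j2, hj2⟩ := h2
  obtain ⟨j3, hj3⟩ := h3
  have := hN.card_fooling_le ![a, b, c, d] ![j1, n, j2, j3]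
    (fun s => by fin_cases s <;> simp [Ma, Mb, Mc, Md, hj1, hj2, hj3, hn])
    (fun s t hst => by
      fin_cases s <;> fin_cases t <;> first
        | exact absurd rfl hst
        | simp [Ma, Mb, Mc, Md, hj1, hj2, hj3, hn])
  omega

theorem zero_or_one_of_add {a b c : ℝ} (ha : a = 0 ∨ a = 1) (hbc : b + c = 0 ∨ b + c = 1)
    (hab : a + b = 0 ∨ a + b = 1) (hac : a + c = 0 ∨ a + c = 1) :
    (a = 0 ∨ a = 1) ∧ (b = 0 ∨ b = 1) ∧ (c = 0 ∨ c = 1) := by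
  grind

theorem zero_or_one_of_pairwise_add {a b c : ℝ} (hab : a + b = 0 ∨ a + b = 1)
    (hac : a + c = 0 ∨ a + c = 1) (hbc : b + c = 0 ∨ b + c = 1)
    (habc : a + b + c = 0 ∨ a + b + c = 1) :
    (a = 0 ∨ a = 1) ∧ (b = 0 ∨ b = 1) ∧ (c = 0 ∨ c = 1) := by
  grind

theorem binDecomp_three_of_antichain {α β : Type*} {M : Matrix α β ℝ} (hM : Is01 M)
    (hN : NNDecomp M 3) (x y z : α → ℝ) (p q r : β → ℝ)
    (hx : ∀ i, x i = 0 ∨ x i = 1) (hy : ∀ i, y i = 0 ∨ y i = 1) (hz : ∀ i, z i = 0 ∨ z i = 1)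
    (h : ∀ i j, M i j = x i * p j + y i * q j + z i * r j)
    (hxy : ∃ i, x i = 1 ∧ y i = 0) (hyx : ∃ i, y i = 1 ∧ x i = 0)
    (hxz : ∃ i, x i = 1 ∧ z i = 0) (hzx : ∃ i, z i = 1 ∧ x i = 0)
    (hyz : ∃ i, y i = 1 ∧ z i = 0) (hzy : ∃ i, z i = 1 ∧ y i = 0) :
    BinDecomp M 3 := by
  have row : ∀ {i : α} {e f g : ℝ}, x i = e ∧ y i = f ∧ z i = g →
      ∀ j, e * p j + f * q j + g * r j = 0 ∨ e * p j + f * q j + g * r j = 1 := by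
    rintro i e f g ⟨rfl, rfl, rfl⟩ j
    rw [← h]
    exact hM i j
  have hX : (∃ i, x i = 1 ∧ y i = 0 ∧ z i = 0) ∨ (¬ ∃ i, x i = 1 ∧ y i = 0 ∧ z i = 0) ∧
      ((∃ i, x i = 1 ∧ y i = 0 ∧ z i = 1) ∧ ∃ i, x i = 1 ∧ y i = 1 ∧ z i = 0) := by grind
  have hY : (∃ i, x i = 0 ∧ y i = 1 ∧ z i = 0) ∨ (¬ ∃ i, x i = 0 ∧ y i = 1 ∧ z i = 0) ∧
      ((∃ i, x i = 0 ∧ y i = 1 ∧ z i = 1) ∧ ∃ i, x i = 1 ∧ y i = 1 ∧ z i = 0) := by grind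
  have hZ : (∃ i, x i = 0 ∧ y i = 0 ∧ z i = 1) ∨ (¬ ∃ i, x i = 0 ∧ y i = 0 ∧ z i = 1) ∧
      ((∃ i, x i = 0 ∧ y i = 1 ∧ z i = 1) ∧ ∃ i, x i = 1 ∧ y i = 0 ∧ z i = 1) := by grind
  have done : (∀ j, (p j = 0 ∨ p j = 1) ∧ (q j = 0 ∨ q j = 1) ∧ (r j = 0 ∨ r j = 1)) →
      BinDecomp M 3 := fun H =>
    binDecomp_three x y z p q r hx hy hz (fun j => (H j).1) (fun j => (H j).2.1)
      (fun j => (H j).2.2) h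
  rcases hX with ⟨a, ha⟩ | ⟨hX, ⟨a, ha⟩, a', ha'⟩ <;>
    rcases hY with ⟨b, hb⟩ | ⟨hY, ⟨b, hb⟩, b', hb'⟩ <;>
    rcases hZ with ⟨c, hc⟩ | ⟨hZ, ⟨c, hc⟩, c', hc'⟩
  · refine done fun j => ⟨?_, ?_, ?_⟩
    · simpa using row ha j
    · simpa using row hb j
    · simpa using row hc j
  · exact binDecomp_three_of_two_private hM hN x y z p q r hx hy hz h ha hb hc hc'
  · exact binDecomp_three_of_two_private hM hN x z y p r q hx hz hy
      (fun i j => by rw [h]; ring) (a := a) (b := c) (c := b) (d := b')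
      (by tauto) (by tauto) (by tauto) (by tauto)
  · refine done fun j => ?_
    have := zero_or_one_of_add (a := p j) (b := q j) (c := r j) (by simpa using row ha j)
      (by simpa using row hb j) (by simpa using row hb' j) (by simpa using row hc' j)
    tauto
  · exact binDecomp_three_of_two_private hM hN y z x q r p hy hz hx
      (fun i j => by rw [h]; ring) (a := b) (b := c) (c := a) (d := a')
      (by tauto) (by tauto) (by tauto) (by tauto)
  · refine done fun j => ?_
    have := zero_or_one_of_add (a := q j) (b := p j) (c := r j) (by simpa using row hb j)
      (by simpa using row ha j) (by simpa [add_comm] using row ha' j) (by simpa using row hc j)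
    tauto
  · refine done fun j => ?_
    have := zero_or_one_of_add (a := r j) (b := p j) (c := q j) (by simpa using row hc j)
      (by simpa using row ha' j) (by simpa [add_comm] using row ha j)
      (by simpa [add_comm] using row hb j)
    tauto
  · have hpq := row ha'
    have hpr := row ha
    have hqr := row hb
    simp only [one_mul, zero_mul, add_zero, zero_add] at hpq hpr hqr
    by_cases hall : ∃ i, x i = 1 ∧ y i = 1 ∧ z i = 1
    · obtain ⟨i, hi⟩ := hall
      have hpqr := row hi
      simp only [one_mul] at hpqr
      refine done fun j => ?_
      exact zero_or_one_of_pairwise_add (hpq j) (hpr j) (hqr j) (hpqr j)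
    have hrow : ∀ i, (x i = 0 ∧ y i = 0 ∧ z i = 0) ∨ (x i = 1 ∧ y i = 1 ∧ z i = 0) ∨
        (x i = 1 ∧ y i = 0 ∧ z i = 1) ∨ (x i = 0 ∧ y i = 1 ∧ z i = 1) := by
      push Not at hall hX hY hZ
      intro i
      have := hall i
      have := hX i
      have := hY i
      have := hZ i
      rcases hx i with h1 | h1 <;> rcases hy i with h2 | h2 <;> rcases hz i with h3 | h3 <;>
        simp_all
    refine binDecomp_three (fun i => (x i + y i - z i) / 2) (fun i => (x i + z i - y i) / 2)
      (fun i => (y i + z i - x i) / 2) (fun j => p j + q j) (fun j => p j + r j)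
      (fun j => q j + r j) (fun i => ?_) (fun i => ?_) (fun i => ?_) hpq hpr hqr
      (fun i j => by rw [h]; ring)
    all_goals obtain hi | hi | hi | hi := hrow i <;> simp [hi]

theorem IndicatorDecomp.binDecomp {α β : Type*} [DecidableEq α] {M : Matrix α β ℝ}
    (hM : Is01 M) {r : ℕ} (hr : r ≤ 3) (hN : r = 3 → NNDecomp M r) (s : Fin r → Finset α)
    (w : Fin r → β → ℝ) (h : IndicatorDecomp M s w) : BinDecomp M r := by
  obtain ⟨s, w, h, hanti⟩ := h.exists_antichain
  have hsep : ∀ k l, k ≠ l → (s k).Nonempty → ∃ i ∈ s k, i ∉ s l := fun k l hkl hk =>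
    Finset.not_subset.1 (hanti k l hkl hk)
  by_cases hr3 : r = 3 ∧ ∀ k, (s k).Nonempty
  · obtain ⟨rfl, hne⟩ := hr3
    have hind : ∀ k i, (if i ∈ s k then (1 : ℝ) else 0) = 0 ∨
        (if i ∈ s k then (1 : ℝ) else 0) = 1 := fun k i => by
      by_cases hi : i ∈ s k <;> simp [hi]
    have hex : ∀ k l, k ≠ l → ∃ i, (if i ∈ s k then (1 : ℝ) else 0) = 1 ∧
        (if i ∈ s l then (1 : ℝ) else 0) = 0 := fun k l hkl => by
      obtain ⟨i, hi, hi'⟩ := hsep k l hkl (hne k)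
      exact ⟨i, by simp [hi], by simp [hi']⟩
    refine binDecomp_three_of_antichain hM (hN rfl) _ _ _ (w 0) (w 1) (w 2)
      (hind 0) (hind 1) (hind 2) (fun i j => ?_)
      (hex 0 1 (by decide)) (hex 1 0 (by decide)) (hex 0 2 (by decide)) (hex 2 0 (by decide))
      (hex 1 2 (by decide)) (hex 2 1 (by decide))
    rw [h, Fin.sum_univ_three]
    simp only [ite_mul, one_mul, zero_mul]
  · refine h.binDecomp_of_private hM fun k hk => ?_
    -- at most one other set is nonempty
    have hother : ∃ l, ∀ m, m ≠ k → m ≠ l → s m = ∅ := by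
      by_cases hr' : r = 3
      · obtain ⟨m, hm⟩ := not_forall.1 fun H => hr3 ⟨hr', H⟩
        rw [Finset.not_nonempty_iff_eq_empty] at hm
        subst hr'
        have hkm : k ≠ m := by rintro rfl; simp [hm] at hk
        obtain ⟨l, hl⟩ : ∃ l : Fin 3, ∀ t, t ≠ k → t ≠ l → t = m := by
          clear hm hk
          revert k m
          decide
        exact ⟨l, fun t h1 h2 => hl t h1 h2 ▸ hm⟩
      · by_cases hl : ∃ l, l ≠ k
        · obtain ⟨l, hl⟩ := hl
          refine ⟨l, fun m hmk hml => ?_⟩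
          have := k.isLt
          have := l.isLt
          have := m.isLt
          have := Fin.val_ne_of_ne hmk
          have := Fin.val_ne_of_ne hml
          have := Fin.val_ne_of_ne hl
          omega
        · exact ⟨k, fun m hmk _ => absurd ⟨m, hmk⟩ hl⟩
    obtain ⟨l, hl⟩ := hother
    obtain ⟨i, hi, hil⟩ : ∃ i ∈ s k, l ≠ k → i ∉ s l := by
      by_cases hkl : l = k
      · exact ⟨hk.choose, hk.choose_spec, fun hne => absurd hkl hne⟩
      · obtain ⟨i, hi, hi'⟩ := hsep k l (Ne.symm hkl) hk
        exact ⟨i, hi, fun _ => hi'⟩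
    refine ⟨i, hi, fun m hmk => ?_⟩
    by_cases hml : m = l
    · subst hml; exact hil hmk
    · simp [hl m hmk hml]

/-- Some columns of a 0-1 matrix span its column space, and the number of columns needed is at most
the nonnegative rank. -/
theorem NNDecomp.exists_indicatorDecomp {α β : Type*} [Fintype α] [DecidableEq α]
    {M : Matrix α β ℝ} (hM : Is01 M) {r : ℕ} (h : NNDecomp M r) :
    ∃ t ≤ r, ∃ (s : Fin t → Finset α) (w : Fin t → β → ℝ), IndicatorDecomp M s w := by
  classical
  obtain ⟨u, v, -, -, huv⟩ := h
  obtain ⟨f, hf, hspan, -⟩ := Submodule.exists_fun_fin_finrank_span_eq ℝ (Set.range M.transpose)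
  have hle : Submodule.span ℝ (Set.range M.transpose) ≤ Submodule.span ℝ (Set.range u) := by
    rw [Submodule.span_le]
    rintro _ ⟨j, rfl⟩
    rw [SetLike.mem_coe, Submodule.mem_span_range_iff_exists_fun]
    refine ⟨fun k => v k j, ?_⟩
    ext i
    simp [huv, mul_comm]
  have hmem : ∀ j, ∃ c : Fin _ → ℝ, ∑ k, c k • f k = M.transpose j := fun j => by
    rw [← Submodule.mem_span_range_iff_exists_fun, hspan]
    exact Submodule.subset_span ⟨j, rfl⟩
  choose w hw using hmem
  refine ⟨_, (Submodule.finrank_mono hle).trans ((finrank_range_le_card u).trans (by simp)),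
    fun k => Finset.univ.filter fun i => f k i = 1, fun k j => w j k, fun i j => ?_⟩
  rw [← Matrix.transpose_apply M, ← hw j, Finset.sum_apply]
  refine Finset.sum_congr rfl fun k _ => ?_
  obtain ⟨j', hj'⟩ := hf k
  have h01 : f k i = 0 ∨ f k i = 1 := by rw [← hj']; exact hM i j'
  rcases h01 with h0 | h1
  · simp [h0]
  · simp [h1]

/-- For every total 0-1 matrix `M`, if `rank₊(M) ≤ 3` then
`rank₊(M) = rank₀₁(M)`. -/
theorem nnRank_le_three_eq_binRank {α β : Type*} [Fintype α] [Fintype β]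
    (M : Matrix α β ℝ) (hM : Is01 M) (h : nnRank M ≤ 3) :
    nnRank M = binRank M := by
  classical
  have hbin : BinDecomp M (binRank M) := Nat.sInf_mem (s := {r | BinDecomp M r}) ⟨_, hM.binDecomp_card⟩
  have hnn : NNDecomp M (nnRank M) := Nat.sInf_mem (s := {r | NNDecomp M r}) ⟨_, hbin.nnDecomp⟩
  refine le_antisymm (Nat.sInf_le hbin.nnDecomp) ?_
  obtain ⟨t, ht, s, w, hsw⟩ := hnn.exists_indicatorDecomp hM
  refine (Nat.sInf_le (hsw.binDecomp hM (ht.trans h) fun ht3 => ?_)).trans ht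
  rwa [show t = nnRank M by omega]
end

section
/- The 5×6 total 0-1 matrix M₅ with rows (1,1,1,0,0,0), (1,0,0,1,1,0), (0,1,0,1,0,1), (0,0,1,0,1,1), (1,1,1,1,1,1) satisfies rank₊(M₅) = 4 and rank₀₁(M₅) = 5. In particular, there exists a total 0-1 matrix whose nonnegative rank is 4 and whose binary rank is 5. -/
/-- The 5×6 matrix from Theorem 2(2). -/
def M5 : Matrix (Fin 5) (Fin 6) ℝ :=
  !![1,1,1,0,0,0;
     1,0,0,1,1,0;
     0,1,0,1,0,1;
     0,0,1,0,1,1;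
     1,1,1,1,1,1]

/-- The column indices of a nonsingular `4 × 4` minor of `M5` (in rows `0, 1, 2, 3`). -/
def M5MinorCols : Fin 4 → Fin 6 := ![0, 1, 3, 2]

theorem det_M5_minor_ne_zero : (M5.submatrix Fin.castSucc M5MinorCols).det ≠ 0 := by
  simp [Matrix.det_succ_row_zero, Fin.sum_univ_succ, M5, M5MinorCols, Fin.succAbove]

theorem le_of_nnDecomp_of_det_ne_zero {α β : Type*} {M : Matrix α β ℝ} {r n : ℕ}
    (h : NNDecomp M r) (a : Fin n → α) (b : Fin n → β) (hdet : (M.submatrix a b).det ≠ 0) :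
    n ≤ r := by
  obtain ⟨u, v, -, -, huv⟩ := h
  have hmul : M.submatrix a b =
      (Matrix.of fun i k => u k (a i)) * (Matrix.of fun k j => v k (b j)) := by
    ext i j
    simp [Matrix.mul_apply, huv]
  have hrank : (M.submatrix a b).rank = n := by
    rw [Matrix.rank_of_isUnit _ ((Matrix.isUnit_iff_isUnit_det _).2 hdet.isUnit), Fintype.card_fin]
  rw [← hrank, hmul]
  exact (Matrix.rank_mul_le_left _ _).trans (by simpa using Matrix.rank_le_width _)

theorem nnDecomp_M5_four : NNDecomp M5 4 := by
  refine ⟨!![1, 0, 0, 0, 1 / 2; 0, 1, 0, 0, 1 / 2; 0, 0, 1, 0, 1 / 2; 0, 0, 0, 1, 1 / 2],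
    fun k j => M5 k.castSucc j, fun k i => ?_, fun k j => ?_, fun i j => ?_⟩
  · fin_cases k <;> fin_cases i <;> simp
  · fin_cases k <;> fin_cases j <;> simp [M5]
  · fin_cases i <;> fin_cases j <;> simp [M5, Fin.sum_univ_succ] <;> norm_num

theorem Is01.binDecomp {n : ℕ} {β : Type*} {M : Matrix (Fin n) β ℝ} (hM : Is01 M) :
    BinDecomp M n :=
  ⟨fun k i => if i = k then 1 else 0, M, fun k i => by dsimp only; split_ifs <;> simp, hM,
    fun i j => by simp⟩

theorem is01_M5 : Is01 M5 := by
  intro i j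
  fin_cases i <;> fin_cases j <;> simp [M5]

theorem M5_last_row (j : Fin 6) : ∑ i : Fin 4, M5 i.castSucc j = 2 ∧ M5 (Fin.last 4) j = 1 := by
  fin_cases j <;> simp [M5, Fin.sum_univ_succ, Fin.last] <;> norm_num

theorem M5_col_injective : Function.Injective fun j i => M5 i j := by
  intro j l h
  have h0 := congrFun h 0
  have h1 := congrFun h 1
  have h2 := congrFun h 2
  fin_cases j <;> fin_cases l <;> simp [M5] at h0 h1 h2 ⊢

theorem not_binDecomp_M5_four : ¬ BinDecomp M5 4 := by
  rintro ⟨u, v, hu, hv, huv⟩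
  let U : Matrix (Fin 4) (Fin 4) ℝ := Matrix.of fun i k => u k i.castSucc
  let V : Matrix (Fin 4) (Fin 4) ℝ := Matrix.of fun k j => v k (M5MinorCols j)
  have hUV : M5.submatrix Fin.castSucc M5MinorCols = U * V := by
    ext i j
    simp [Matrix.mul_apply, huv, U, V]
  have hdet := det_M5_minor_ne_zero
  rw [hUV, Matrix.det_mul] at hdet
  -- The last row of `M5` is half the sum of the others, hence so is the last entry of each `u k`.
  have hsum : (fun k => ∑ i : Fin 4, u k i.castSucc - 2 * u k (Fin.last 4)) = 0 := by
    refine Matrix.eq_zero_of_vecMul_eq_zero (right_ne_zero_of_mul hdet) ?_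
    ext j
    obtain ⟨h2, h1⟩ := M5_last_row (M5MinorCols j)
    simp only [huv] at h1 h2
    rw [Finset.sum_comm] at h2
    simp only [Matrix.vecMul, dotProduct, V, Matrix.of_apply, sub_mul, Finset.sum_sub_distrib,
      Finset.sum_mul, mul_assoc, ← Finset.mul_sum, Pi.zero_apply]
    linarith
  have hlast (k : Fin 4) : u k (Fin.last 4) = 1 := by
    refine (hu k _).resolve_left fun h0 => left_ne_zero_of_mul hdet ?_
    refine Matrix.det_eq_zero_of_column_eq_zero k fun i => ?_
    have hk := congrFun hsum k
    simp only [h0, mul_zero, sub_zero, Pi.zero_apply] at hk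
    refine (Finset.sum_eq_zero_iff_of_nonneg fun i _ => ?_).1 hk i (Finset.mem_univ i)
    rcases hu k i.castSucc with h | h <;> simp [h]
  have hcol (j : Fin 6) : ∃ k, ∀ i, M5 i j = u k i := by
    have hone : ∑ k, v k j = 1 := by
      have h := (M5_last_row j).2
      simpa only [huv, hlast, one_mul] using h
    obtain ⟨k, -, hk⟩ := Finset.exists_ne_zero_of_sum_ne_zero (hone.trans_ne one_ne_zero)
    have hk1 : v k j = 1 := (hv k j).resolve_left hk
    have hrest : ∑ l ∈ Finset.univ.erase k, v l j = 0 := by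
      have h := Finset.add_sum_erase Finset.univ (fun l => v l j) (Finset.mem_univ k)
      linarith
    refine ⟨k, fun i => ?_⟩
    rw [huv, Finset.sum_eq_single k, hk1, mul_one]
    · intro l _ hl
      have hvl : v l j = 0 :=
        (Finset.sum_eq_zero_iff_of_nonneg fun l _ => by
          rcases hv l j with h | h <;> simp [h]).1 hrest l (by simp [hl])
      rw [hvl, mul_zero]
    · simp
  choose f hf using hcol
  obtain ⟨j, l, hne, hjl⟩ := Fintype.exists_ne_map_eq_of_card_lt f (by simp)
  exact hne (M5_col_injective (funext fun i => by simp only [hf, hjl]))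

/-- The matrix `M5` satisfies `rank₊(M5) = 4` and `rank₀₁(M5) = 5`;
in particular there is a total 0-1 matrix with nonnegative rank 4 and binary rank 5. -/
theorem rank_four_five : nnRank M5 = 4 ∧ binRank M5 = 5 := by
  have hle {r : ℕ} (h : NNDecomp M5 r) : 4 ≤ r :=
    le_of_nnDecomp_of_det_ne_zero h _ _ det_M5_minor_ne_zero
  constructor
  · exact IsLeast.csInf_eq ⟨nnDecomp_M5_four, fun r hr => hle hr⟩
  · refine IsLeast.csInf_eq ⟨is01_M5.binDecomp, fun r hr => ?_⟩
    refine Nat.lt_of_le_of_ne (hle (BinDecomp.nnDecomp hr)) ?_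
    rintro rfl
    exact not_binDecomp_M5_four hr
end
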